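/- For every natural number s and every ε > 0 there is a constant C(s,ε) such that for all real X ≥ 1 one has J_{s,3}(X) ≤ C(s,ε) · X^ε · ( X^s + X^{2s−6} ). In other words, the Main Conjecture in Vinogradov's mean value theorem holds for J_{s,3}(X). -/

import Mathlib

/-- `J s k X` counts the 2s-tuples of integers `(x₁,…,x_s,y₁,…,y_s)` with
`1 ≤ xᵢ, yᵢ ≤ X` satisfying `x₁^j + … + x_s^j = y₁^j + … + y_s^j` for `1 ≤ j ≤ k`. -/
noncomputable def J (s k : ℕ) (X : ℝ) : ℕ :=
  Set.ncard {p : (Fin s → ℤ) × (Fin s → ℤ) |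
    (∀ i, 1 ≤ p.1 i ∧ (p.1 i : ℝ) ≤ X) ∧ (∀ i, 1 ≤ p.2 i ∧ (p.2 i : ℝ) ≤ X) ∧
    ∀ j ∈ Finset.Icc 1 k, ∑ i, p.1 i ^ j = ∑ i, p.2 i ^ j}

namespace VMVT

open Finset

set_option linter.unusedSectionVars false

/-- The finite group of moment vectors mod `N`. -/
abbrev V (N : ℕ) := ZMod N × ZMod N × ZMod N

/-- point on the twisted cubic -/
def pw (N : ℕ) (n : ℤ) : V N := ((n : ZMod N), (n : ZMod N) ^ 2, (n : ZMod N) ^ 3)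

/-- Average over the dual group. -/
noncomputable def av (N : ℕ) [NeZero N] (g : AddChar (V N) ℂ → ℝ) : ℝ :=
  (∑ ψ, g ψ) / (Fintype.card (V N) : ℝ)

/-- Exponential sum. -/
noncomputable def f (N : ℕ) (S : Finset ℤ) (ψ : AddChar (V N) ℂ) : ℂ := ∑ n ∈ S, ψ (pw N n)

section framework
variable {N : ℕ} [NeZero N]

lemma card_pos' : (0 : ℝ) < (Fintype.card (V N) : ℝ) := by
  exact_mod_cast Fintype.card_pos

lemma av_nonneg {g : AddChar (V N) ℂ → ℝ} (h : ∀ ψ, 0 ≤ g ψ) : 0 ≤ av N g :=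
  div_nonneg (sum_nonneg fun ψ _ => h ψ) card_pos'.le

lemma av_mono {g h : AddChar (V N) ℂ → ℝ} (H : ∀ ψ, g ψ ≤ h ψ) : av N g ≤ av N h :=
  div_le_div_of_nonneg_right (sum_le_sum fun ψ _ => H ψ) card_pos'.le

lemma av_add (g h : AddChar (V N) ℂ → ℝ) : av N (fun ψ => g ψ + h ψ) = av N g + av N h := by
  simp [av, sum_add_distrib, add_div]

lemma av_smul (c : ℝ) (g : AddChar (V N) ℂ → ℝ) : av N (fun ψ => c * g ψ) = c * av N g := by
  simp [av, ← mul_sum, mul_div_assoc]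

lemma av_sum {ι : Type*} (s : Finset ι) (g : ι → AddChar (V N) ℂ → ℝ) :
    av N (fun ψ => ∑ i ∈ s, g i ψ) = ∑ i ∈ s, av N (g i) := by
  simp only [av]
  rw [sum_comm, sum_div]

lemma av_holder {F G : AddChar (V N) ℂ → ℝ} (hF : ∀ ψ, 0 ≤ F ψ) (hG : ∀ ψ, 0 ≤ G ψ)
    {θ : ℝ} (h0 : 0 < θ) (h1 : θ < 1) :
    av N (fun ψ => F ψ ^ θ * G ψ ^ (1 - θ)) ≤ av N F ^ θ * av N G ^ (1 - θ) := by
  have hpq : Real.HolderConjugate (θ⁻¹) ((1 - θ)⁻¹) := by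
    rw [Real.holderConjugate_iff]
    refine ⟨(one_lt_inv₀ h0).2 h1, ?_⟩
    simp
  have key := Real.inner_le_Lp_mul_Lq_of_nonneg (s := univ) (f := fun ψ => F ψ ^ θ)
    (g := fun ψ => G ψ ^ (1 - θ)) hpq (fun ψ _ => Real.rpow_nonneg (hF ψ) _)
    (fun ψ _ => Real.rpow_nonneg (hG ψ) _)
  have e1 : ∀ ψ, (F ψ ^ θ) ^ θ⁻¹ = F ψ := fun ψ => by
    rw [← Real.rpow_mul (hF ψ), mul_inv_cancel₀ h0.ne', Real.rpow_one]
  have e2 : ∀ ψ, (G ψ ^ (1 - θ)) ^ (1 - θ)⁻¹ = G ψ := fun ψ => by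
    rw [← Real.rpow_mul (hG ψ), mul_inv_cancel₀ (by linarith), Real.rpow_one]
  simp only [e1, e2, one_div, inv_inv] at key
  unfold av
  have hc := card_pos' (N := N)
  set c : ℝ := (Fintype.card (V N) : ℝ)
  rw [Real.div_rpow (sum_nonneg fun ψ _ => hF ψ) hc.le,
    Real.div_rpow (sum_nonneg fun ψ _ => hG ψ) hc.le, div_mul_div_comm,
    ← Real.rpow_add hc, add_sub_cancel, Real.rpow_one]
  exact div_le_div_of_nonneg_right key hc.le

lemma interp_pt {x y : ℝ} (hx : 0 ≤ x) (hy : 0 ≤ y) {i j k l m n : ℕ} {θ : ℝ} (h0 : 0 < θ)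
    (h1 : θ < 1) (hm : (m : ℝ) = i * θ + k * (1 - θ)) (hn : (n : ℝ) = j * θ + l * (1 - θ)) :
    x ^ m * y ^ n = (x ^ i * y ^ j) ^ θ * (x ^ k * y ^ l) ^ (1 - θ) := by
  have h1' : 0 ≤ 1 - θ := by linarith
  rw [Real.mul_rpow (by positivity) (by positivity), Real.mul_rpow (by positivity) (by positivity)]
  simp only [← Real.rpow_natCast]
  rw [← Real.rpow_mul hx, ← Real.rpow_mul hx, ← Real.rpow_mul hy, ← Real.rpow_mul hy, hm, hn,
    Real.rpow_add_of_nonneg hx (by positivity) (by positivity),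
    Real.rpow_add_of_nonneg hy (by positivity) (by positivity)]
  ring

/-- mixed moments -/
noncomputable def I (N : ℕ) [NeZero N] (S T : Finset ℤ) (m n : ℕ) : ℝ :=
  av N fun ψ => ‖f N S ψ‖ ^ m * ‖f N T ψ‖ ^ n

lemma I_nonneg (S T : Finset ℤ) (m n : ℕ) : 0 ≤ I N S T m n :=
  av_nonneg fun ψ => by positivity

lemma I_comm (S T : Finset ℤ) (m n : ℕ) : I N S T m n = I N T S n m := by
  unfold I; simp only [mul_comm]

lemma I_interp (S T : Finset ℤ) {i j k l m n : ℕ} (θ : ℝ) (h0 : 0 < θ)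
    (h1 : θ < 1) (hm : (m : ℝ) = i * θ + k * (1 - θ)) (hn : (n : ℝ) = j * θ + l * (1 - θ)) :
    I N S T m n ≤ I N S T i j ^ θ * I N S T k l ^ (1 - θ) := by
  have := av_holder (N := N) (F := fun ψ => ‖f N S ψ‖ ^ i * ‖f N T ψ‖ ^ j)
    (G := fun ψ => ‖f N S ψ‖ ^ k * ‖f N T ψ‖ ^ l) (fun ψ => by positivity) (fun ψ => by positivity)
    h0 h1
  refine le_trans (le_of_eq ?_) this
  unfold I
  congr 1
  funext ψ
  exact interp_pt (norm_nonneg _) (norm_nonneg _) h0 h1 hm hn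

lemma sum_char (v : V N) : (∑ ψ : AddChar (V N) ℂ, ψ v) =
    if v = 0 then (Fintype.card (V N) : ℂ) else 0 := by
  classical
  exact AddChar.sum_apply_eq_ite v

lemma normsq_sum {κ : Type*} (U : Finset κ) (w : κ → V N) (ψ : AddChar (V N) ℂ) :
    ((‖∑ k ∈ U, ψ (w k)‖ ^ 2 : ℝ) : ℂ) = ∑ k ∈ U, ∑ l ∈ U, ψ (w k - w l) := by
  push_cast
  rw [← Complex.mul_conj', map_sum, sum_mul_sum]
  refine sum_congr rfl fun k _ => sum_congr rfl fun l _ => ?_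
  rw [sub_eq_add_neg, AddChar.map_add_eq_mul, AddChar.map_neg_eq_conj]

lemma restrict {ι κ : Type*} [DecidableEq ι] (T S : Finset ι) (hST : S ⊆ T) (v : ι → V N)
    (U : Finset κ) (w : κ → V N)
    (h : ∀ i ∈ T, i ∉ S → ∀ k ∈ U, ∀ l ∈ U, v i + (w k - w l) ≠ 0) :
    ∑ ψ : AddChar (V N) ℂ, (∑ i ∈ T, ψ (v i)) * ((‖∑ k ∈ U, ψ (w k)‖ ^ 2 : ℝ) : ℂ) =
    ∑ ψ : AddChar (V N) ℂ, (∑ i ∈ S, ψ (v i)) * ((‖∑ k ∈ U, ψ (w k)‖ ^ 2 : ℝ) : ℂ) := by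
  simp only [sum_mul]
  rw [sum_comm, sum_comm (s := univ) (t := S)]
  symm
  refine sum_subset hST fun i hi hiS => ?_
  simp only [normsq_sum, mul_sum, ← AddChar.map_add_eq_mul]
  rw [sum_comm]
  refine sum_eq_zero fun k hk => ?_
  rw [sum_comm]
  refine sum_eq_zero fun l hl => ?_
  rw [sum_char, if_neg (h i hi hiS k hk l hl)]

lemma f_pow (S : Finset ℤ) (ψ : AddChar (V N) ℂ) (m : ℕ) :
    f N S ψ ^ m = ∑ x ∈ Fintype.piFinset (fun _ : Fin m => S), ψ (∑ i, pw N (x i)) := by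
  unfold f
  rw [sum_pow']
  refine sum_congr rfl fun x _ => ?_
  exact (map_prod ψ.toMonoidHom (fun i => Multiplicative.ofAdd (pw N (x i))) univ).symm

lemma norm_f_pow (S : Finset ℤ) (ψ : AddChar (V N) ℂ) (m : ℕ) :
    ‖f N S ψ‖ ^ (2 * m) =
      ‖∑ x ∈ Fintype.piFinset (fun _ : Fin m => S), ψ (∑ i, pw N (x i))‖ ^ 2 := by
  rw [← f_pow, norm_pow, ← pow_mul, mul_comm]

lemma norm_f_le (S : Finset ℤ) (ψ : AddChar (V N) ℂ) : ‖f N S ψ‖ ≤ S.card := by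
  unfold f
  refine (norm_sum_le _ _).trans ?_
  simp [AddChar.norm_apply]

end framework

/-- Number of solutions over the integers. -/
noncomputable def JZ (m : ℕ) (S : Finset ℤ) : ℕ :=
  #{z ∈ Fintype.piFinset (fun _ : Fin m => S) ×ˢ Fintype.piFinset (fun _ : Fin m => S) |
    ∑ i, z.1 i = ∑ i, z.2 i ∧ ∑ i, z.1 i ^ 2 = ∑ i, z.2 i ^ 2 ∧ ∑ i, z.1 i ^ 3 = ∑ i, z.2 i ^ 3}

lemma J_eq (m : ℕ) (X : ℝ) : J m 3 X = JZ m (Icc 1 ⌊X⌋) := by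
  unfold J JZ
  rw [← Set.ncard_coe_finset]
  congr 1
  ext ⟨x, y⟩
  have : Icc 1 3 = ({1, 2, 3} : Finset ℕ) := by decide
  simp only [Set.mem_ofPred_eq, coe_filter, mem_product, Fintype.mem_piFinset, mem_Icc, this,
    Int.le_floor]
  simp [and_assoc]

section count
variable {N : ℕ} [NeZero N]

lemma av_count {κ : Type*} (U : Finset κ) (w : κ → V N) :
    av N (fun ψ => ‖∑ k ∈ U, ψ (w k)‖ ^ 2) = #{z ∈ U ×ˢ U | w z.1 = w z.2} := by
  classical
  unfold av
  rw [div_eq_iff card_pos'.ne']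
  apply Complex.ofReal_injective
  rw [Complex.ofReal_sum]
  simp only [normsq_sum]
  rw [sum_comm]
  simp only [sum_comm (s := univ) (t := U), sum_char, sub_eq_zero]
  rw [← sum_product' (f := fun k l => if w k = w l then (Fintype.card (V N) : ℂ) else 0),
    ← sum_filter, sum_const]
  simp

lemma pw_sum {m : ℕ} (x : Fin m → ℤ) : ∑ i, pw N (x i) =
    (((∑ i, x i : ℤ) : ZMod N), ((∑ i, x i ^ 2 : ℤ) : ZMod N), ((∑ i, x i ^ 3 : ℤ) : ZMod N)) := by
  simp only [pw]
  ext <;> simp [Prod.fst_sum, Prod.snd_sum]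

lemma av_f_pow (S : Finset ℤ) (m : ℕ) : av N (fun ψ => ‖f N S ψ‖ ^ (2 * m)) =
    #{z ∈ Fintype.piFinset (fun _ : Fin m => S) ×ˢ Fintype.piFinset (fun _ : Fin m => S) |
      ∑ i, pw N (z.1 i) = ∑ i, pw N (z.2 i)} := by
  simp only [norm_f_pow]
  exact av_count _ _

lemma cast_eq_small {a b B : ℤ} (ha : 0 ≤ a) (ha' : a ≤ B) (hb : 0 ≤ b) (hb' : b ≤ B)
    (hN : B < N) (h : (a : ZMod N) = b) : a = b := by
  rw [ZMod.intCast_eq_intCast_iff] at h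
  have := h.eq
  rwa [Int.emod_eq_of_lt ha (by omega), Int.emod_eq_of_lt hb (by omega)] at this

lemma av_eq_JZ {X : ℕ} {S : Finset ℤ} (hS : S ⊆ Icc 1 (X : ℤ)) (m : ℕ) (hN : m * X ^ 3 < N) :
    av N (fun ψ => ‖f N S ψ‖ ^ (2 * m)) = JZ m S := by
  rw [av_f_pow, JZ]
  congr 2
  ext ⟨x, y⟩
  simp only [mem_filter, mem_product, Fintype.mem_piFinset, and_congr_right_iff]
  rintro ⟨hx, hy⟩
  have hb : ∀ z : Fin m → ℤ, (∀ i, z i ∈ S) → ∀ j, j ≤ 3 → 0 ≤ ∑ i, z i ^ j ∧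
      ∑ i, z i ^ j ≤ ((m * X ^ 3 : ℕ) : ℤ) := by
    intro z hz j hj
    have hz' : ∀ i, 1 ≤ z i ∧ z i ≤ X := fun i => mem_Icc.1 (hS (hz i))
    refine ⟨sum_nonneg fun i _ => pow_nonneg (by linarith [hz' i]) _, ?_⟩
    calc ∑ i, z i ^ j ≤ ∑ i : Fin m, (X : ℤ) ^ 3 := sum_le_sum fun i _ => ?_
      _ = _ := by simp
    calc z i ^ j ≤ z i ^ 3 := pow_le_pow_right₀ (hz' i).1 hj
      _ ≤ _ := pow_le_pow_left₀ (by linarith [hz' i]) (hz' i).2 _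
  have hN' : ((m * X ^ 3 : ℕ) : ℤ) < N := by exact_mod_cast hN
  have hc : ∀ j, j ≤ 3 → (((∑ i, x i ^ j : ℤ) : ZMod N) = ((∑ i, y i ^ j : ℤ) : ZMod N) ↔
      ∑ i, x i ^ j = ∑ i, y i ^ j) := fun j hj =>
    ⟨fun h => cast_eq_small (hb x hx j hj).1 (hb x hx j hj).2 (hb y hy j hj).1 (hb y hy j hj).2
      hN' h, fun h => by rw [h]⟩
  have h1 := hc 1 (by norm_num)
  simp only [pow_one] at h1
  rw [pw_sum, pw_sum, Prod.mk.injEq, Prod.mk.injEq, h1, hc 2 (by norm_num), hc 3 (by norm_num)]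

lemma JZ_mono (m : ℕ) {S T : Finset ℤ} (h : S ⊆ T) : JZ m S ≤ JZ m T := by
  unfold JZ
  apply card_le_card
  apply filter_subset_filter
  exact product_subset_product (Fintype.piFinset_subset _ _ fun _ => h)
    (Fintype.piFinset_subset _ _ fun _ => h)

lemma JZ_affine (m : ℕ) {S T : Finset ℤ} (g : ℤ → ℤ) (q r : ℤ) (hq : q ≠ 0)
    (hg : ∀ n ∈ S, g n ∈ T ∧ n = q * g n + r) : JZ m S ≤ JZ m T := by
  unfold JZ
  refine card_le_card_of_injOn (fun z => (fun i => g (z.1 i), fun i => g (z.2 i))) ?_ ?_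
  · rintro ⟨x, y⟩ h
    simp only [coe_filter, mem_product, Fintype.mem_piFinset, Set.mem_ofPred_eq] at h ⊢
    obtain ⟨⟨hx, hy⟩, h1, h2, h3⟩ := h
    refine ⟨⟨fun i => (hg _ (hx i)).1, fun i => (hg _ (hy i)).1⟩, ?_⟩
    have ex : ∀ i, x i = q * g (x i) + r := fun i => (hg _ (hx i)).2
    have ey : ∀ i, y i = q * g (y i) + r := fun i => (hg _ (hy i)).2
    obtain ⟨x', hX⟩ : ∃ x' : Fin m → ℤ, ∀ i, g (x i) = x' i := ⟨_, fun _ => rfl⟩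
    obtain ⟨y', hY⟩ : ∃ y' : Fin m → ℤ, ∀ i, g (y i) = y' i := ⟨_, fun _ => rfl⟩
    have ex' : ∀ i, x i = q * x' i + r := fun i => by rw [← hX]; exact ex i
    have ey' : ∀ i, y i = q * y' i + r := fun i => by rw [← hY]; exact ey i
    simp only [hX, hY]
    simp only [ex', ey'] at h1 h2 h3
    have g1 : ∑ i, x' i = ∑ i, y' i := by
      simp only [sum_add_distrib, ← mul_sum] at h1
      exact mul_left_cancel₀ hq (by linarith)
    have g2 : ∑ i, x' i ^ 2 = ∑ i, y' i ^ 2 := by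
      have e : ∀ t : ℤ, (q * t + r) ^ 2 = q ^ 2 * t ^ 2 + (2 * q * r) * t + r ^ 2 := fun t => by ring
      simp only [e, sum_add_distrib, ← mul_sum, g1] at h2
      exact mul_left_cancel₀ (pow_ne_zero 2 hq) (by linarith)
    refine ⟨g1, g2, ?_⟩
    have e : ∀ t : ℤ, (q * t + r) ^ 3 =
      q ^ 3 * t ^ 3 + (3 * q ^ 2 * r) * t ^ 2 + (3 * q * r ^ 2) * t + r ^ 3 := fun t => by ring
    simp only [e, sum_add_distrib, ← mul_sum, g1, g2] at h3
    exact mul_left_cancel₀ (pow_ne_zero 3 hq) (by linarith)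
  · rintro ⟨x, y⟩ h ⟨x', y'⟩ h' heq
    simp only [coe_filter, mem_product, Fintype.mem_piFinset, Set.mem_ofPred_eq] at h h'
    simp only [Prod.mk.injEq, funext_iff] at heq ⊢
    refine ⟨fun i => ?_, fun i => ?_⟩
    · rw [(hg _ (h.1.1 i)).2, (hg _ (h'.1.1 i)).2, heq.1 i]
    · rw [(hg _ (h.1.2 i)).2, (hg _ (h'.1.2 i)).2, heq.2 i]

/-- the residue class of `ξ` mod `q` within `[1,X]` -/
noncomputable def cl (X : ℕ) (q ξ : ℤ) : Finset ℤ := {n ∈ Icc 1 (X : ℤ) | q ∣ n - ξ}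

lemma cl_sub (X : ℕ) (q ξ : ℤ) : cl X q ξ ⊆ Icc 1 (X : ℤ) := filter_subset _ _

lemma JZ_cl (m X q : ℕ) (hq : 0 < q) (ξ : ℤ) :
    JZ m (cl X q ξ) ≤ JZ m (Icc 1 ((X / q + 1 : ℕ) : ℤ)) := by
  refine JZ_affine m (fun n => n / q + 1) q (ξ % q - q) (by exact_mod_cast hq.ne') ?_
  intro n hn
  simp only [cl, mem_filter, mem_Icc] at hn ⊢
  obtain ⟨⟨h1, h2⟩, h3⟩ := hn
  have hq' : (0 : ℤ) < q := by exact_mod_cast hq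
  refine ⟨⟨?_, ?_⟩, ?_⟩
  · have := Int.ediv_nonneg (by linarith : 0 ≤ n) hq'.le
    linarith
  · push_cast
    have := Int.ediv_le_ediv hq' h2
    linarith
  · have e1 : ξ % q = n % q := (Int.emod_emod_of_dvd _ (dvd_refl _) ▸ (Int.emod_eq_emod_iff_emod_sub_eq_zero.2 (Int.emod_eq_zero_of_dvd h3)).symm)
    rw [e1]
    have := Int.mul_ediv_add_emod n q
    linarith

end count

end VMVT

namespace VMVT
open Finset
set_option linter.unusedSectionVars false

lemma prod_le_sum_pow {m : ℕ} (hm : 1 ≤ m) (c : Fin m → ℝ) (hc : ∀ i, 0 ≤ c i) :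
    ∏ i, c i ≤ ∑ i, c i ^ m := by
  have : Nonempty (Fin m) := ⟨⟨0, hm⟩⟩
  obtain ⟨i0, -, h⟩ := exists_max_image (univ : Finset (Fin m)) c univ_nonempty
  calc ∏ i, c i ≤ ∏ _i : Fin m, c i0 := prod_le_prod (fun i _ => hc i) fun i hi => h i hi
    _ = c i0 ^ m := by simp
    _ ≤ _ := single_le_sum (f := fun i => c i ^ m) (fun i _ => pow_nonneg (hc i) _) (mem_univ i0)

lemma prod_le_sum_pow2 {m : ℕ} (hm : 1 ≤ m) (a b : Fin m → ℝ) (_ : ∀ i, 0 ≤ a i)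
    (_ : ∀ i, 0 ≤ b i) :
    (∏ i, a i) * ∏ i, b i ≤ ∑ i, a i ^ (2 * m) + ∑ i, b i ^ (2 * m) := by
  have h1 := prod_le_sum_pow hm (fun i => a i ^ 2) (fun i => by positivity)
  have h2 := prod_le_sum_pow hm (fun i => b i ^ 2) (fun i => by positivity)
  simp only [prod_pow, ← pow_mul] at h1 h2
  nlinarith [sq_nonneg (∏ i, a i - ∏ i, b i), sq_nonneg (∏ i, a i), sq_nonneg (∏ i, b i)]

section
variable {N : ℕ} [NeZero N]

lemma sum_class {m : ℕ} (A : Fin m → Finset ℤ) (B : Fin m → Finset ℤ) (ψ : AddChar (V N) ℂ) :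
    ∑ z ∈ Fintype.piFinset A ×ˢ Fintype.piFinset B,
      ψ (∑ i, pw N (z.1 i) - ∑ i, pw N (z.2 i)) =
    (∏ i, f N (A i) ψ) * (starRingEnd ℂ) (∏ i, f N (B i) ψ) := by
  have e : ∀ C : Fin m → Finset ℤ, ∏ i, f N (C i) ψ =
      ∑ x ∈ Fintype.piFinset C, ψ (∑ i, pw N (x i)) := by
    intro C
    unfold f
    rw [prod_univ_sum]
    refine sum_congr rfl fun x _ => ?_
    exact (map_prod ψ.toMonoidHom (fun i => Multiplicative.ofAdd (pw N (x i))) univ).symm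
  rw [e, e, map_sum, sum_mul_sum, sum_product]
  refine sum_congr rfl fun k _ => sum_congr rfl fun l _ => ?_
  rw [sub_eq_add_neg, AddChar.map_add_eq_mul, AddChar.map_neg_eq_conj]

lemma sieve (A B : Finset ℤ) (q : ℤ) {m n : ℕ} (hm : 1 ≤ m)
    (Gd : Finset ((Fin m → ℤ) × (Fin m → ℤ))) (K : ℝ)
    (hK : ∀ g ∈ Gd, ∀ i, I N {x ∈ A | x % q = g.1 i} B (2 * m) (2 * n) ≤ K ∧
      I N {x ∈ A | x % q = g.2 i} B (2 * m) (2 * n) ≤ K)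
    (h : ∀ x y : Fin m → ℤ, (∀ i, x i ∈ A) → (∀ i, y i ∈ A) → ∀ u w : Fin n → ℤ,
      (∀ i, u i ∈ B) → (∀ i, w i ∈ B) →
      ∑ i, pw N (x i) - ∑ i, pw N (y i) + (∑ i, pw N (u i) - ∑ i, pw N (w i)) = 0 →
      ((fun i => x i % q, fun i => y i % q) : (Fin m → ℤ) × (Fin m → ℤ)) ∈ Gd) :
    I N A B (2 * m) (2 * n) ≤ #Gd * (2 * m * K) := by
  classical
  set T := Fintype.piFinset (fun _ : Fin m => A) ×ˢ Fintype.piFinset (fun _ : Fin m => A) with hT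
  set U := Fintype.piFinset (fun _ : Fin n => B) with hU
  let res : (Fin m → ℤ) × (Fin m → ℤ) → (Fin m → ℤ) × (Fin m → ℤ) :=
    fun z => (fun i => z.1 i % q, fun i => z.2 i % q)
  set S := T.filter (fun z => res z ∈ Gd) with hS
  let v : (Fin m → ℤ) × (Fin m → ℤ) → V N := fun z => ∑ i, pw N (z.1 i) - ∑ i, pw N (z.2 i)
  have hr := restrict T S (filter_subset _ _) v U (fun u => ∑ i, pw N (u i)) (by
    intro z hz hzS u hu w hw h0
    apply hzS
    rw [hS, mem_filter]
    refine ⟨hz, ?_⟩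
    simp only [hT, hU, mem_product, Fintype.mem_piFinset] at hz hu hw
    exact h z.1 z.2 hz.1 hz.2 u w hu hw h0)
  have e1 : ((∑ ψ : AddChar (V N) ℂ, ‖f N A ψ‖ ^ (2 * m) * ‖f N B ψ‖ ^ (2 * n) : ℝ) : ℂ) =
      ∑ ψ : AddChar (V N) ℂ, (∑ i ∈ T, ψ (v i)) *
        ((‖∑ k ∈ U, ψ (∑ i, pw N (k i))‖ ^ 2 : ℝ) : ℂ) := by
    rw [Complex.ofReal_sum]
    refine sum_congr rfl fun ψ _ => ?_
    rw [Complex.ofReal_mul, norm_f_pow, norm_f_pow, normsq_sum, hT, sum_product]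
  rw [hr] at e1
  have pt : ∀ ψ : AddChar (V N) ℂ, ‖∑ z ∈ S, ψ (v z)‖ ≤ ∑ g ∈ Gd,
      (∑ i, ‖f N {x ∈ A | x % q = g.1 i} ψ‖ ^ (2 * m) +
       ∑ i, ‖f N {x ∈ A | x % q = g.2 i} ψ‖ ^ (2 * m)) := by
    intro ψ
    rw [← sum_fiberwise_of_maps_to (s := S) (t := Gd) (g := res)
      (fun z hz => (mem_filter.1 hz).2)]
    refine (norm_sum_le _ _).trans (sum_le_sum fun g hg => ?_)
    have : S.filter (fun z => res z = g) =
        Fintype.piFinset (fun i => {x ∈ A | x % q = g.1 i}) ×ˢ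
        Fintype.piFinset (fun i => {x ∈ A | x % q = g.2 i}) := by
      ext z
      simp only [hS, hT, mem_filter, mem_product, Fintype.mem_piFinset, res]
      constructor
      · rintro ⟨⟨⟨h1, h2⟩, -⟩, h3⟩
        rw [← h3]
        exact ⟨fun i => ⟨h1 i, rfl⟩, fun i => ⟨h2 i, rfl⟩⟩
      · rintro ⟨h1, h2⟩
        have : ((fun i => z.1 i % q, fun i => z.2 i % q) : (Fin m → ℤ) × (Fin m → ℤ)) = g :=
          Prod.ext (funext fun i => (h1 i).2) (funext fun i => (h2 i).2)
        exact ⟨⟨⟨fun i => (h1 i).1, fun i => (h2 i).1⟩, by rw [this]; exact hg⟩, this⟩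
    rw [this, sum_class, norm_mul, RCLike.norm_conj, norm_prod, norm_prod]
    exact prod_le_sum_pow2 hm _ _ (fun _ => norm_nonneg _) (fun _ => norm_nonneg _)
  have e2 : I N A B (2 * m) (2 * n) ≤ av N (fun ψ => ∑ g ∈ Gd,
      (∑ i, ‖f N {x ∈ A | x % q = g.1 i} ψ‖ ^ (2 * m) * ‖f N B ψ‖ ^ (2 * n) +
       ∑ i, ‖f N {x ∈ A | x % q = g.2 i} ψ‖ ^ (2 * m) * ‖f N B ψ‖ ^ (2 * n))) := by
    unfold I av
    refine div_le_div_of_nonneg_right ?_ card_pos'.le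
    refine (le_abs_self _).trans ?_
    beta_reduce
    rw [← Real.norm_eq_abs, ← Complex.norm_real, e1]
    refine (norm_sum_le _ _).trans (sum_le_sum fun ψ _ => ?_)
    simp only [← sum_mul, ← add_mul]
    rw [norm_mul, Complex.norm_real, Real.norm_of_nonneg (by positivity), ← norm_f_pow]
    exact mul_le_mul_of_nonneg_right (pt ψ) (by positivity)
  refine e2.trans ?_
  rw [av_sum, ← nsmul_eq_mul]
  refine sum_le_card_nsmul _ _ _ fun g hg => ?_
  rw [av_add, av_sum, av_sum]
  have s1 := sum_le_card_nsmul (univ : Finset (Fin m)) _ K fun i _ => (hK g hg i).1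
  have s2 := sum_le_card_nsmul (univ : Finset (Fin m)) _ K fun i _ => (hK g hg i).2
  simp only [card_univ, Fintype.card_fin, nsmul_eq_mul] at s1 s2
  calc _ ≤ (m : ℝ) * K + m * K := add_le_add s1 s2
    _ = _ := by ring

end
end VMVT

namespace VMVT
open Finset
set_option linter.unusedSectionVars false

lemma dcast {a b c : ℤ} (h : a ∣ b) (e : c = b) : a ∣ c := e ▸ h

lemma shift {N : ℕ} [NeZero N] {m n : ℕ} (P η : ℤ) (hP : P ^ 3 ∣ (N : ℤ)) (x y : Fin m → ℤ) (u w : Fin n → ℤ)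
    (hu : ∀ i, P ∣ u i - η) (hw : ∀ i, P ∣ w i - η)
    (h : ∑ i, pw N (x i) - ∑ i, pw N (y i) + (∑ i, pw N (u i) - ∑ i, pw N (w i)) = 0) :
    P ^ 2 ∣ ∑ i, (x i - η) ^ 2 - ∑ i, (y i - η) ^ 2 ∧
    P ^ 3 ∣ ∑ i, (x i - η) ^ 3 - ∑ i, (y i - η) ^ 3 := by
  simp only [pw_sum, Prod.mk_sub_mk, Prod.mk_add_mk, Prod.mk_eq_zero] at h
  obtain ⟨h1, h2, h3⟩ := h
  have c1 := (ZMod.intCast_zmod_eq_zero_iff_dvd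
    (∑ i, x i - ∑ i, y i + (∑ i, u i - ∑ i, w i)) N).1 (by rw [← h1]; push_cast; ring)
  have c2 := (ZMod.intCast_zmod_eq_zero_iff_dvd
    (∑ i, x i ^ 2 - ∑ i, y i ^ 2 + (∑ i, u i ^ 2 - ∑ i, w i ^ 2)) N).1
      (by rw [← h2]; push_cast; ring)
  have c3 := (ZMod.intCast_zmod_eq_zero_iff_dvd
    (∑ i, x i ^ 3 - ∑ i, y i ^ 3 + (∑ i, u i ^ 3 - ∑ i, w i ^ 3)) N).1
      (by rw [← h3]; push_cast; ring)
  have e2 : ∀ {k : ℕ} (z : Fin k → ℤ), ∑ i, (z i - η) ^ 2 =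
      ∑ i, z i ^ 2 - 2 * η * ∑ i, z i + k * η ^ 2 := by
    intro k z
    have : ∀ t : ℤ, (t - η) ^ 2 = t ^ 2 - 2 * η * t + η ^ 2 := fun t => by ring
    simp [this, sum_add_distrib, sum_sub_distrib, mul_sum]
  have e3 : ∀ {k : ℕ} (z : Fin k → ℤ), ∑ i, (z i - η) ^ 3 =
      ∑ i, z i ^ 3 - 3 * η * ∑ i, z i ^ 2 + 3 * η ^ 2 * ∑ i, z i - k * η ^ 3 := by
    intro k z
    have : ∀ t : ℤ, (t - η) ^ 3 = t ^ 3 - 3 * η * t ^ 2 + 3 * η ^ 2 * t - η ^ 3 := fun t => by ring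
    simp [this, sum_add_distrib, sum_sub_distrib, mul_sum]
  have d : ∀ (j : ℕ) (z : Fin n → ℤ), (∀ i, P ∣ z i - η) → P ^ j ∣ ∑ i, (z i - η) ^ j :=
    fun j z hz => dvd_sum fun i _ => pow_dvd_pow_of_dvd (hz i) j
  have q2 : P ^ 2 ∣ (N : ℤ) := (pow_dvd_pow P (by norm_num)).trans hP
  constructor
  · have a1 := dvd_sub (d 2 u hu) (d 2 w hw)
    have a2 := q2.trans (dvd_sub c2 (c1.mul_left (2 * η)))
    have := dvd_sub a2 a1
    refine dcast this ?_
    rw [e2, e2, e2, e2]; ring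
  · have a1 := dvd_sub (d 3 u hu) (d 3 w hw)
    have a2 := hP.trans (dvd_add (dvd_sub c3 (c2.mul_left (3 * η))) (c1.mul_left (3 * η ^ 2)))
    have := dvd_sub a2 a1
    refine dcast this ?_
    rw [e3, e3, e3, e3]; ring

section nt
variable {p : ℤ}

lemma cube_lift (hp : Prime p) (h3 : ¬ p ∣ 3) {k : ℕ} {s t : ℤ} (hst : p ∣ s - t) (hs : ¬ p ∣ s)
    (h : p ^ k ∣ s ^ 3 - t ^ 3) : p ^ k ∣ s - t := by
  refine Prime.pow_dvd_of_dvd_mul_right hp k (b := s ^ 2 + s * t + t ^ 2) ?_ ?_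
  · intro hd
    have : p ∣ 3 * s ^ 2 := by
      have := dvd_add hd (hst.mul_left (t + 2 * s))
      refine dcast this ?_; ring
    rcases hp.dvd_or_dvd this with h | h
    · exact h3 h
    · exact hs (hp.dvd_of_dvd_pow h)
  · refine dcast h ?_; ring

/-- the eliminant -/
def El (s1 s2 t1 t2 : ℤ) : ℤ :=
  3 * (s1 + t1) * (s2 + t2) * ((s1 + t1) - (s2 + t2)) + (s2 + t2) * (s1 - t1) ^ 2
    - (s1 + t1) * (t2 - s2) ^ 2

lemma exists_e (hp : Prime p) {a b : ℕ} (hab : a ≤ b) {ζ s1 s2 t1 t2 : ℤ}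
    (hs1 : p ^ a ∣ s1 - ζ) (hs2 : p ^ a ∣ s2 - ζ) (ht1 : p ^ a ∣ t1 - ζ) (ht2 : p ^ a ∣ t2 - ζ)
    (h2 : p ^ (2 * b) ∣ s1 ^ 2 + s2 ^ 2 - (t1 ^ 2 + t2 ^ 2))
    (h3 : p ^ (3 * b) ∣ s1 ^ 3 + s2 ^ 3 - (t1 ^ 3 + t2 ^ 3)) :
    ∃ e, a ≤ e ∧ e ≤ 2 * b - a ∧ p ^ e ∣ s1 - t1 ∧ p ^ (2 * b - e) ∣ El s1 s2 t1 t2 := by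
  have hd : p ^ a ∣ s1 - t1 := by have := dvd_sub hs1 ht1; refine dcast this ?_; ring
  by_cases ht : p ^ (2 * b - a) ∣ s1 - t1
  · refine ⟨2 * b - a, by omega, le_rfl, ht, ?_⟩
    have : 2 * b - (2 * b - a) = a := by omega
    rw [this]
    have hd2 : p ^ a ∣ t2 - s2 := by have := dvd_sub ht2 hs2; refine dcast this ?_; ring
    have hσ : p ^ a ∣ (s1 + t1) - (s2 + t2) := by
      have := dvd_sub (dvd_add hs1 ht1) (dvd_add hs2 ht2); refine dcast this ?_; ring
    unfold El
    refine dvd_sub (dvd_add (hσ.mul_left _) ?_) ?_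
    · rw [pow_two]; exact (hd.mul_left _).mul_left _
    · rw [pow_two (t2 - s2)]; exact (hd2.mul_left _).mul_left _
  · have hE : p ^ (2 * b) ∣ (s1 - t1) * El s1 s2 t1 t2 := by
      have h3' : p ^ (2 * b) ∣ s1 ^ 3 + s2 ^ 3 - (t1 ^ 3 + t2 ^ 3) :=
        (pow_dvd_pow p (by omega)).trans h3
      have := dvd_sub (h3'.mul_left (4 * (s2 + t2)))
        (h2.mul_left (3 * (s2 + t2) ^ 2 + (t2 - s2) ^ 2))
      refine dcast this ?_
      unfold El; ring
    have hne : s1 - t1 ≠ 0 := by rintro h; rw [h] at ht; exact ht (dvd_zero _)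
    have hfin : FiniteMultiplicity p (s1 - t1) :=
      FiniteMultiplicity.of_prime_left hp hne
    obtain ⟨c, hc, hpc⟩ := hfin.exists_eq_pow_mul_and_not_dvd
    set e := multiplicity p (s1 - t1)
    have hae : a ≤ e := hfin.le_multiplicity_of_pow_dvd hd
    have hep : p ^ e ∣ s1 - t1 := ⟨c, hc⟩
    have het : e < 2 * b - a := by
      by_contra! hh
      exact ht ((pow_dvd_pow p hh).trans hep)
    refine ⟨e, hae, het.le, hep, ?_⟩
    rw [hc, show 2 * b = e + (2 * b - e) by omega, pow_add, mul_assoc] at hE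
    have := Int.dvd_of_mul_dvd_mul_left (pow_ne_zero _ hp.ne_zero) hE
    exact Prime.pow_dvd_of_dvd_mul_left hp _ hpc this

lemma unit_sum (hp : Prime p) (h2 : ¬ p ∣ 2) {ζ s t : ℤ} (hζ : ¬ p ∣ ζ) (hs : p ∣ s - ζ)
    (ht : p ∣ t - ζ) : ¬ p ∣ s + t := by
  intro h
  have : p ∣ 2 * ζ := by
    have := dvd_sub h (dvd_add hs ht); refine dcast this ?_; ring
  rcases hp.dvd_or_dvd this with h | h
  · exact h2 h
  · exact hζ h

lemma uniq1 (hp : Prime p) (h2 : ¬ p ∣ 2) {k : ℕ} {ζ s1 t1 s2 t2 t2' : ℤ} (hζ : ¬ p ∣ ζ)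
    (ht : p ∣ t2 - ζ) (ht' : p ∣ t2' - ζ)
    (h : p ^ k ∣ (s1 - t1) * (s1 + t1) - (t2 - s2) * (s2 + t2))
    (h' : p ^ k ∣ (s1 - t1) * (s1 + t1) - (t2' - s2) * (s2 + t2')) : p ^ k ∣ t2 - t2' := by
  refine Prime.pow_dvd_of_dvd_mul_right hp k (b := t2 + t2') (unit_sum hp h2 hζ ht ht') ?_
  have := dvd_sub h' h
  refine dcast this ?_; ring

lemma uniq2 (hp : Prime p) (h2 : ¬ p ∣ 2) (h3 : ¬ p ∣ 3) {k r : ℕ} (hrk : r ≤ k)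
    {ζ s1 t1 s2 t2 s2' t2' : ℤ} (hζ : ¬ p ∣ ζ)
    (hs1 : p ∣ s1 - ζ) (ht1 : p ∣ t1 - ζ)
    (hs2 : p ∣ s2 - ζ) (ht2 : p ∣ t2 - ζ) (hs2' : p ∣ s2' - ζ) (ht2' : p ∣ t2' - ζ)
    (h : p ^ k ∣ (s1 - t1) * (s1 + t1) - (t2 - s2) * (s2 + t2))
    (h' : p ^ k ∣ (s1 - t1) * (s1 + t1) - (t2' - s2') * (s2' + t2'))
    (hE : p ^ r ∣ El s1 s2 t1 t2) (hE' : p ^ r ∣ El s1 s2' t1 t2') : p ^ r ∣ s2 - s2' := by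
  have hD : p ^ r ∣ (t2 - s2) * (s2 + t2) - (t2' - s2') * (s2' + t2') := by
    have := (pow_dvd_pow p hrk).trans (dvd_sub h' h)
    refine dcast this ?_; ring
  have hσ2 := unit_sum hp h2 hζ hs2 ht2
  have hΔ : p ^ r ∣ (s2 + t2) - (s2' + t2') := by
    refine Prime.pow_dvd_of_dvd_mul_right hp r
      (b := 3 * (s1 + t1) * (s2 + t2) * ((s1 + t1) - (s2 + t2) - (s2' + t2'))
        + (s2 + t2) * (s1 - t1) ^ 2 + (s1 + t1) * (t2' - s2') * ((t2 - s2) + (t2' - s2'))) ?_ ?_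
    · intro hW
      have k1 : p ∣ s1 - t1 := by have := dvd_sub hs1 ht1; refine dcast this ?_; ring
      have k2 : p ∣ t2' - s2' := by have := dvd_sub ht2' hs2'; refine dcast this ?_; ring
      have k3 : p ∣ 3 * ((s1 + t1) * ((s2 + t2) * (s2' + t2'))) := by
        have q1 : p ∣ (s1 + t1) - (s2 + t2) := by
          have := dvd_sub (dvd_add hs1 ht1) (dvd_add hs2 ht2); refine dcast this ?_; ring
        have := dvd_sub (dvd_add (dvd_add (q1.mul_left (3 * (s1 + t1) * (s2 + t2)))
          (k1.mul_left ((s2 + t2) * (s1 - t1))))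
          (k2.mul_left ((s1 + t1) * ((t2 - s2) + (t2' - s2'))))) hW
        refine dcast this ?_; ring
      rcases hp.dvd_or_dvd k3 with h | h
      · exact h3 h
      rcases hp.dvd_or_dvd h with h | h
      · exact unit_sum hp h2 hζ hs1 ht1 h
      rcases hp.dvd_or_dvd h with h | h
      · exact hσ2 h
      · exact unit_sum hp h2 hζ hs2' ht2' h
    · have := dvd_add ((dvd_sub hE hE').mul_left (s2 + t2))
        (hD.mul_left ((s1 + t1) * ((t2 - s2) + (t2' - s2'))))
      refine dcast this ?_
      unfold El; ring
  have hd : p ^ r ∣ (t2 - s2) - (t2' - s2') := by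
    refine Prime.pow_dvd_of_dvd_mul_right hp r (b := s2 + t2) hσ2 ?_
    have := dvd_sub hD (hΔ.mul_left (t2' - s2'))
    refine dcast this ?_; ring
  refine Prime.pow_dvd_of_dvd_mul_right hp r (b := 2) h2 ?_
  have := dvd_sub hΔ hd
  refine dcast this ?_; ring

end nt

lemma card_class {p : ℕ} (hp : 0 < p) {k t : ℕ} (hkt : k ≤ t) (z : ℤ) :
    #{x ∈ Ico (0 : ℤ) ((p : ℤ) ^ t) | (p : ℤ) ^ k ∣ x - z} ≤ p ^ (t - k) := by
  have hp' : (0 : ℤ) < (p : ℤ) ^ k := by positivity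
  have : #(Ico (0 : ℤ) ((p : ℤ) ^ (t - k))) = p ^ (t - k) := by
    rw [Int.card_Ico, sub_zero]; exact_mod_cast Int.toNat_natCast (p ^ (t - k))
  rw [← this]
  refine card_le_card_of_injOn (fun x => x / (p : ℤ) ^ k) ?_ ?_
  · intro x hx
    simp only [coe_filter, mem_Ico, Set.mem_ofPred_eq, coe_Ico, Set.mem_Ico] at hx ⊢
    refine ⟨Int.ediv_nonneg hx.1.1 hp'.le, Int.ediv_lt_of_lt_mul hp' ?_⟩
    rw [← pow_add, Nat.sub_add_cancel hkt]; exact hx.1.2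
  · intro x hx y hy hxy
    simp only [coe_filter, mem_Ico, Set.mem_ofPred_eq] at hx hy hxy
    have h1 : (p : ℤ) ^ k ∣ x - y := by
      have := dvd_sub hx.2 hy.2; refine dcast this ?_; ring
    have h2 : x % (p : ℤ) ^ k = y % (p : ℤ) ^ k :=
      Int.emod_eq_emod_iff_emod_sub_eq_zero.2 (Int.emod_eq_zero_of_dvd h1)
    rw [← Int.mul_ediv_add_emod x ((p : ℤ) ^ k), ← Int.mul_ediv_add_emod y ((p : ℤ) ^ k), h2, hxy]

end VMVT

namespace VMVT
open Finset
set_option linter.unusedSectionVars false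

section
variable {N p X : ℕ} [NeZero N]

lemma filter_cl {a t : ℕ} (hat : a ≤ t) {ξ r : ℤ} (h0 : 0 ≤ r)
    (h1 : r < (p : ℤ) ^ t) (hr : (p : ℤ) ^ a ∣ r - ξ) :
    {x ∈ cl X ((p : ℤ) ^ a) ξ | x % (p : ℤ) ^ t = r} = cl X ((p : ℤ) ^ t) r := by
  ext x
  simp only [cl, mem_filter, mem_Icc]
  constructor
  · rintro ⟨⟨hx, -⟩, h⟩
    refine ⟨hx, ?_⟩
    have := Int.mul_ediv_add_emod x ((p : ℤ) ^ t)
    exact ⟨x / (p : ℤ) ^ t, by rw [h] at this; linarith⟩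
  · rintro ⟨hx, h⟩
    refine ⟨⟨hx, ?_⟩, ?_⟩
    · exact dcast (dvd_add ((pow_dvd_pow (p : ℤ) hat).trans h) hr) (by ring)
    · have := Int.emod_eq_emod_iff_emod_sub_eq_zero.2 (Int.emod_eq_zero_of_dvd h)
      rw [this, Int.emod_eq_of_lt h0 h1]

lemma prime_facts (hp : p.Prime) (hp5 : 5 ≤ p) :
    Prime (p : ℤ) ∧ ¬ (p : ℤ) ∣ 2 ∧ ¬ (p : ℤ) ∣ 3 := by
  refine ⟨Nat.prime_iff_prime_int.1 hp, fun h => ?_, fun h => ?_⟩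
  · have := Int.le_of_dvd (by norm_num) h
    omega
  · have := Int.le_of_dvd (by norm_num) h
    omega

lemma mem_res {a t : ℕ} (hp : 0 < p) (hat : a ≤ t) {ξ x : ℤ} (hx : (p : ℤ) ^ a ∣ x - ξ) :
    0 ≤ x % (p : ℤ) ^ t ∧ x % (p : ℤ) ^ t < (p : ℤ) ^ t ∧ (p : ℤ) ^ a ∣ x % (p : ℤ) ^ t - ξ := by
  have hpt : (0 : ℤ) < (p : ℤ) ^ t := by positivity
  refine ⟨Int.emod_nonneg _ hpt.ne', Int.emod_lt_of_pos _ hpt, ?_⟩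
  have h1 : (p : ℤ) ^ t ∣ x - x % (p : ℤ) ^ t := Int.dvd_self_sub_emod
  exact dcast (dvd_sub hx ((pow_dvd_pow (p : ℤ) hat).trans h1)) (by ring)

lemma not_dvd_of {a : ℕ} (ha : 1 ≤ a) {ξ η r : ℤ} (h : ¬ (p : ℤ) ∣ ξ - η)
    (hr : (p : ℤ) ^ a ∣ r - ξ) : ¬ (p : ℤ) ∣ r - η := by
  intro hd
  apply h
  have := (dvd_pow_self (p : ℤ) (by omega : a ≠ 0)).trans hr
  exact dcast (dvd_sub hd this) (by ring)

lemma lem3 (hp : p.Prime) (hp5 : 5 ≤ p) {a b : ℕ} (ha : 1 ≤ a) (hab : a ≤ 3 * b)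
    (hN : p ^ (3 * b) ∣ N) {ξ η : ℤ} (h : ¬ (p : ℤ) ∣ ξ - η) {K : ℝ}
    (hK : ∀ ξ' : ℤ, ¬ (p : ℤ) ∣ ξ' - η →
      I N (cl X ((p : ℤ) ^ (3 * b)) ξ') (cl X ((p : ℤ) ^ b) η) 2 10 ≤ K) :
    I N (cl X ((p : ℤ) ^ a) ξ) (cl X ((p : ℤ) ^ b) η) 2 10 ≤ (p : ℝ) ^ (3 * b - a) * (2 * K) := by
  classical
  obtain ⟨hP, -, h3⟩ := prime_facts hp hp5
  have hK0 : 0 ≤ K := (I_nonneg _ _ _ _).trans (hK ξ h)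
  set R := {x ∈ Ico (0 : ℤ) ((p : ℤ) ^ (3 * b)) | (p : ℤ) ^ a ∣ x - ξ} with hR
  let G : Finset ((Fin 1 → ℤ) × (Fin 1 → ℤ)) := R.image fun r => (fun _ => r, fun _ => r)
  have hG : #G ≤ p ^ (3 * b - a) := card_image_le.trans (card_class hp.pos hab ξ)
  have key := sieve (N := N) (cl X ((p : ℤ) ^ a) ξ) (cl X ((p : ℤ) ^ b) η) ((p : ℤ) ^ (3 * b))
    (m := 1) (n := 5) le_rfl G K ?_ ?_
  · refine key.trans ?_
    have : (#G : ℝ) ≤ (p : ℝ) ^ (3 * b - a) := by exact_mod_cast hG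
    push_cast
    rw [mul_one]
    exact mul_le_mul_of_nonneg_right this (by positivity)
  · intro g hg i
    obtain ⟨r, hr, rfl⟩ := mem_image.1 hg
    simp only [hR, mem_filter, mem_Ico] at hr
    rw [filter_cl hab hr.1.1 hr.1.2 hr.2]
    have := hK r (not_dvd_of ha h hr.2)
    exact ⟨this, this⟩
  · intro x y hx hy u w hu hw h0
    have hs := (shift ((p : ℤ) ^ b) η (by rw [← pow_mul, mul_comm]; exact_mod_cast hN) x y u w
      (fun i => (mem_filter.1 (hu i)).2) (fun i => (mem_filter.1 (hw i)).2) h0).2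
    simp only [univ_unique, sum_singleton, ← pow_mul, mul_comm b 3] at hs
    have hx0 := (mem_filter.1 (hx default)).2
    have hy0 := (mem_filter.1 (hy default)).2
    have hd := cube_lift hP h3 (k := 3 * b) (s := x default - η) (t := y default - η)
      ((dvd_pow_self (p : ℤ) (by omega : a ≠ 0)).trans
        (dcast (dvd_sub hx0 hy0) (by ring))) (not_dvd_of ha h hx0) hs
    have hd' : (p : ℤ) ^ (3 * b) ∣ x default - y default := dcast hd (by ring)
    have he := Int.emod_eq_emod_iff_emod_sub_eq_zero.2 (Int.emod_eq_zero_of_dvd hd')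
    refine mem_image.2 ⟨x default % (p : ℤ) ^ (3 * b), ?_, ?_⟩
    · have := mem_res hp.pos hab hx0
      simp only [hR, mem_filter, mem_Ico]
      exact ⟨⟨this.1, this.2.1⟩, this.2.2⟩
    · refine Prod.ext (funext fun i => ?_) (funext fun i => ?_)
      · rw [Subsingleton.elim i default]
      · rw [Subsingleton.elim i default, he]

/-- good residue tuples at level `e` -/
noncomputable def Ge (p a b e : ℕ) (ξ η : ℤ) : Finset ((Fin 2 → ℤ) × (Fin 2 → ℤ)) :=
  let R := {x ∈ Ico (0 : ℤ) ((p : ℤ) ^ (2 * b - a)) | (p : ℤ) ^ a ∣ x - ξ}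
  {z ∈ Fintype.piFinset (fun _ => R) ×ˢ Fintype.piFinset (fun _ => R) |
    (p : ℤ) ^ e ∣ z.1 0 - z.2 0 ∧
    (p : ℤ) ^ (2 * b - a) ∣ ((z.1 0 - η) - (z.2 0 - η)) * ((z.1 0 - η) + (z.2 0 - η)) -
      ((z.2 1 - η) - (z.1 1 - η)) * ((z.1 1 - η) + (z.2 1 - η)) ∧
    (p : ℤ) ^ (2 * b - e) ∣ El (z.1 0 - η) (z.1 1 - η) (z.2 0 - η) (z.2 1 - η)}

lemma card_Ge (hp : p.Prime) (hp5 : 5 ≤ p) {a b e : ℕ} (ha : 1 ≤ a) (hab : a ≤ b) (hae : a ≤ e)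
    (heb : e ≤ 2 * b - a) {ξ η : ℤ} (h : ¬ (p : ℤ) ∣ ξ - η) :
    #(Ge p a b e ξ η) ≤ p ^ (4 * (b - a)) := by
  classical
  obtain ⟨hP, h2, h3⟩ := prime_facts hp hp5
  set t := 2 * b - a with ht
  set R := {x ∈ Ico (0 : ℤ) ((p : ℤ) ^ t) | (p : ℤ) ^ a ∣ x - ξ} with hR
  have hcR : #R ≤ p ^ (t - a) := card_class hp.pos (by omega) ξ
  have hRη : ∀ x ∈ R, (p : ℤ) ∣ (x - η) - (ξ - η) := fun x hx =>
    (dvd_pow_self (p : ℤ) (by omega : a ≠ 0)).trans (dcast (mem_filter.1 hx).2 (by ring))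
  have hRI : ∀ x ∈ R, 0 ≤ x ∧ x < (p : ℤ) ^ t := fun x hx => mem_Ico.1 (mem_filter.1 hx).1
  have hmem : ∀ z ∈ Ge p a b e ξ η, (∀ i, z.1 i ∈ R) ∧ (∀ i, z.2 i ∈ R) ∧
    (p : ℤ) ^ e ∣ z.1 0 - z.2 0 ∧
    (p : ℤ) ^ t ∣ ((z.1 0 - η) - (z.2 0 - η)) * ((z.1 0 - η) + (z.2 0 - η)) -
      ((z.2 1 - η) - (z.1 1 - η)) * ((z.1 1 - η) + (z.2 1 - η)) ∧
    (p : ℤ) ^ (2 * b - e) ∣ El (z.1 0 - η) (z.1 1 - η) (z.2 0 - η) (z.2 1 - η) := by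
    intro z hz
    simp only [Ge, mem_filter (p := fun z : (Fin 2 → ℤ) × (Fin 2 → ℤ) => _ ∧ _ ∧ _), mem_product,
      Fintype.mem_piFinset] at hz
    exact ⟨hz.1.1, hz.1.2, hz.2⟩
  let Pe := {w ∈ R ×ˢ R | (p : ℤ) ^ e ∣ w.1 - w.2}
  have hPe : #Pe ≤ p ^ (t - e) * p ^ (t - a) := by
    refine (card_le_mul_card_image_of_maps_to (f := Prod.fst) (t := R) ?_ (p ^ (t - e)) ?_).trans
      (Nat.mul_le_mul_left _ hcR)
    · intro w hw
      exact (mem_product.1 (mem_filter.1 hw).1).1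
    · intro x hx
      refine le_trans ?_ (card_class hp.pos heb x)
      refine card_le_card_of_injOn Prod.snd ?_ ?_
      · rintro ⟨w1, w2⟩ hw
        simp only [Pe, coe_filter, mem_filter, mem_product, Set.mem_ofPred_eq] at hw ⊢
        obtain ⟨⟨⟨-, hw2⟩, hd⟩, rfl⟩ := hw
        refine ⟨mem_Ico.2 (hRI _ hw2), ?_⟩
        rw [← dvd_neg]; exact dcast hd (by ring)
      · rintro ⟨w1, w2⟩ hw ⟨w1', w2'⟩ hw' heq
        simp only [coe_filter, Set.mem_ofPred_eq] at hw hw' heq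
        rw [Prod.mk.injEq]
        exact ⟨hw.2.trans hw'.2.symm, heq⟩
  have hfib : #(Ge p a b e ξ η) ≤ p ^ (t - (2 * b - e)) * #Pe := by
    refine card_le_mul_card_image_of_maps_to (f := fun z => (z.1 0, z.2 0)) (t := Pe) ?_ _ ?_
    · intro z hz
      obtain ⟨z1, z2, z3, -⟩ := hmem z hz
      exact mem_filter.2 ⟨mem_product.2 ⟨z1 0, z2 0⟩, z3⟩
    · rintro ⟨x1, y1⟩ -
      rcases (Finset.eq_empty_or_nonempty {z ∈ Ge p a b e ξ η | (z.1 0, z.2 0) = (x1, y1)}) with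
        he | ⟨z0, hz0⟩
      · rw [he]; simp
      refine le_trans ?_ (card_class hp.pos (by omega : 2 * b - e ≤ t) (z0.1 1))
      rw [mem_filter, Prod.mk.injEq] at hz0
      obtain ⟨hz0, hx0, hy0⟩ := hz0
      obtain ⟨a1, a2, a3, a4, a5⟩ := hmem z0 hz0
      refine card_le_card_of_injOn (fun z => z.1 1) ?_ ?_
      · intro z hz
        rw [mem_coe, mem_filter, Prod.mk.injEq] at hz
        obtain ⟨hz, hx, hy⟩ := hz
        obtain ⟨b1, b2, b3, b4, b5⟩ := hmem z hz
        rw [mem_coe, mem_filter]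
        refine ⟨mem_Ico.2 (hRI _ (b1 1)), ?_⟩
        rw [hx, hy] at b4 b5
        rw [hx0, hy0] at a4 a5
        have := uniq2 hP h2 h3 (k := t) (r := 2 * b - e) (by omega) (ζ := ξ - η) h
          (hx ▸ hRη _ (b1 0)) (hy ▸ hRη _ (b2 0)) (hRη _ (b1 1)) (hRη _ (b2 1)) (hRη _ (a1 1))
          (hRη _ (a2 1)) b4 a4 b5 a5
        exact dcast this (by ring)
      · intro z hz z' hz' heq
        rw [mem_coe, mem_filter, Prod.mk.injEq] at hz hz'
        obtain ⟨hz, hx, hy⟩ := hz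
        obtain ⟨hz', hx', hy'⟩ := hz'
        obtain ⟨b1, b2, b3, b4, b5⟩ := hmem z hz
        obtain ⟨c1, c2, c3, c4, c5⟩ := hmem z' hz'
        simp only at heq
        rw [hx, hy] at b4
        rw [hx', hy', ← heq] at c4
        have hu := uniq1 hP h2 (ζ := ξ - η) h (hRη _ (b2 1)) (hRη _ (c2 1)) b4 c4
        have hu' : (p : ℤ) ^ t ∣ z.2 1 - z'.2 1 := dcast hu (by ring)
        have he := Int.emod_eq_emod_iff_emod_sub_eq_zero.2 (Int.emod_eq_zero_of_dvd hu')
        rw [Int.emod_eq_of_lt (hRI _ (b2 1)).1 (hRI _ (b2 1)).2,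
          Int.emod_eq_of_lt (hRI _ (c2 1)).1 (hRI _ (c2 1)).2] at he
        refine Prod.ext (funext fun i => ?_) (funext fun i => ?_)
        · fin_cases i
          · exact hx.trans hx'.symm
          · exact heq
        · fin_cases i
          · exact hy.trans hy'.symm
          · exact he
  refine hfib.trans ((Nat.mul_le_mul_left _ hPe).trans (le_of_eq ?_))
  rw [← pow_add, ← pow_add]
  congr 1
  omega

lemma El_mod {q M : ℤ} (hM : M ∣ q) (η x1 x2 y1 y2 : ℤ)
    (h : M ∣ El (x1 - η) (x2 - η) (y1 - η) (y2 - η)) :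
    M ∣ El (x1 % q - η) (x2 % q - η) (y1 % q - η) (y2 % q - η) := by
  have e : ∀ x : ℤ, x % q ≡ x [ZMOD M] := fun x => (Int.mod_modEq x q).of_dvd hM
  rw [← Int.modEq_zero_iff_dvd] at h ⊢
  refine Int.ModEq.trans ?_ h
  unfold El
  have e' : ∀ x : ℤ, x % q - η ≡ x - η [ZMOD M] := fun x => (e x).sub_right _
  have s1 := (e' x1).add (e' y1)
  have s2 := (e' x2).add (e' y2)
  exact ((((s1.mul_left 3).mul s2).mul (s1.sub s2)).add (s2.mul (((e' x1).sub (e' y1)).pow 2))).sub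
    (s1.mul (((e' y2).sub (e' x2)).pow 2))

lemma lem4 (hp : p.Prime) (hp5 : 5 ≤ p) {a b : ℕ} (ha : 1 ≤ a) (hab : a ≤ b)
    (hN : p ^ (3 * b) ∣ N) {ξ η : ℤ} (h : ¬ (p : ℤ) ∣ ξ - η) {K : ℝ}
    (hK : ∀ ξ' : ℤ, ¬ (p : ℤ) ∣ ξ' - η →
      I N (cl X ((p : ℤ) ^ (2 * b - a)) ξ') (cl X ((p : ℤ) ^ b) η) 4 8 ≤ K) :
    I N (cl X ((p : ℤ) ^ a) ξ) (cl X ((p : ℤ) ^ b) η) 4 8 ≤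
      (2 * b : ℝ) * (p : ℝ) ^ (4 * (b - a)) * (4 * K) := by
  classical
  obtain ⟨hP, h2, h3⟩ := prime_facts hp hp5
  have hK0 : 0 ≤ K := (I_nonneg _ _ _ _).trans (hK ξ h)
  let G := (Icc a (2 * b - a)).biUnion fun e => Ge p a b e ξ η
  have hG : #G ≤ (2 * b) * p ^ (4 * (b - a)) := by
    refine (card_biUnion_le_card_mul _ _ (p ^ (4 * (b - a))) fun e he => ?_).trans ?_
    · rw [mem_Icc] at he
      exact card_Ge hp hp5 ha hab he.1 he.2 h
    · refine Nat.mul_le_mul_right _ ?_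
      rw [Nat.card_Icc]; omega
  have hat : a ≤ 2 * b - a := by omega
  have key := sieve (N := N) (cl X ((p : ℤ) ^ a) ξ) (cl X ((p : ℤ) ^ b) η)
    ((p : ℤ) ^ (2 * b - a)) (m := 2) (n := 4) (by norm_num) G K ?_ ?_
  · refine key.trans ?_
    have : (#G : ℝ) ≤ (2 * b : ℝ) * (p : ℝ) ^ (4 * (b - a)) := by exact_mod_cast hG
    refine mul_le_mul this (le_of_eq (by push_cast; ring)) (by positivity) (by positivity)
  · intro g hg i
    obtain ⟨e, -, hge⟩ := mem_biUnion.1 hg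
    simp only [Ge, mem_filter, mem_product, Fintype.mem_piFinset, mem_Ico] at hge
    obtain ⟨⟨g1, g2⟩, -⟩ := hge
    rw [filter_cl hat (g1 i).1.1 (g1 i).1.2 (g1 i).2, filter_cl hat (g2 i).1.1 (g2 i).1.2 (g2 i).2]
    exact ⟨hK _ (not_dvd_of ha h (g1 i).2), hK _ (not_dvd_of ha h (g2 i).2)⟩
  · intro x y hx hy u w hu hw h0
    obtain ⟨s2, s3⟩ := shift ((p : ℤ) ^ b) η (by rw [← pow_mul, mul_comm]; exact_mod_cast hN)
      x y u w (fun i => (mem_filter.1 (hu i)).2) (fun i => (mem_filter.1 (hw i)).2) h0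
    simp only [Fin.sum_univ_two, ← pow_mul, mul_comm b] at s2 s3
    have hx' := fun i => (mem_filter.1 (hx i)).2
    have hy' := fun i => (mem_filter.1 (hy i)).2
    obtain ⟨e, he1, he2, he3, he4⟩ := exists_e hP hab (ζ := ξ - η)
      (dcast (hx' 0) (by ring)) (dcast (hx' 1) (by ring)) (dcast (hy' 0) (by ring))
      (dcast (hy' 1) (by ring)) s2 s3
    refine mem_biUnion.2 ⟨e, mem_Icc.2 ⟨he1, he2⟩, ?_⟩
    simp only [Ge, mem_filter, mem_product, Fintype.mem_piFinset, mem_Ico]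
    have hmr := fun i => mem_res hp.pos hat (hx' i)
    have hmr' := fun i => mem_res hp.pos hat (hy' i)
    have em : ∀ z : ℤ, z % (p : ℤ) ^ (2 * b - a) ≡ z [ZMOD (p : ℤ) ^ (2 * b - a)] :=
      fun z => Int.mod_modEq z _
    refine ⟨⟨fun i => ⟨⟨(hmr i).1, (hmr i).2.1⟩, (hmr i).2.2⟩,
      fun i => ⟨⟨(hmr' i).1, (hmr' i).2.1⟩, (hmr' i).2.2⟩⟩, ?_, ?_, ?_⟩
    · have he3' : (p : ℤ) ^ e ∣ x 0 - y 0 := dcast he3 (by ring)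
      rw [← Int.modEq_zero_iff_dvd] at he3' ⊢
      exact (((em (x 0)).sub (em (y 0))).of_dvd (pow_dvd_pow _ he2)).trans he3'
    · have s2' : (p : ℤ) ^ (2 * b - a) ∣ ((x 0 - η) - (y 0 - η)) * ((x 0 - η) + (y 0 - η)) -
          ((y 1 - η) - (x 1 - η)) * ((x 1 - η) + (y 1 - η)) :=
        dcast ((pow_dvd_pow _ (by omega)).trans s2) (by ring)
      rw [← Int.modEq_zero_iff_dvd] at s2' ⊢
      refine Int.ModEq.trans ?_ s2'
      have e' : ∀ z : ℤ, z % (p : ℤ) ^ (2 * b - a) - η ≡ z - η [ZMOD (p : ℤ) ^ (2 * b - a)] :=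
        fun z => (em z).sub_right _
      exact (((e' _).sub (e' _)).mul ((e' _).add (e' _))).sub
        (((e' _).sub (e' _)).mul ((e' _).add (e' _)))
    · exact El_mod (pow_dvd_pow _ (by omega)) _ _ _ _ _ he4

end
end VMVT

namespace VMVT
open Finset
set_option linter.unusedSectionVars false

section
variable {N p X : ℕ} [NeZero N]

lemma lem5 (hp : p.Prime) (hp5 : 5 ≤ p) {a b : ℕ} (ha : 1 ≤ a) (hab : a ≤ b)
    (hN : p ^ (3 * b) ∣ N) {ξ η : ℤ} (h : ¬ (p : ℤ) ∣ ξ - η) {K1 K2 K3 : ℝ}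
    (hK1 : ∀ ξ η : ℤ, ¬ (p : ℤ) ∣ ξ - η →
      I N (cl X ((p : ℤ) ^ b) ξ) (cl X ((p : ℤ) ^ (2 * b - a)) η) 4 8 ≤ K1)
    (hK2 : ∀ ξ η : ℤ, ¬ (p : ℤ) ∣ ξ - η →
      I N (cl X ((p : ℤ) ^ b) ξ) (cl X ((p : ℤ) ^ (3 * b)) η) 4 8 ≤ K2)
    (hK3 : ∀ η : ℤ, av N (fun ψ => ‖f N (cl X ((p : ℤ) ^ b) η) ψ‖ ^ 12) ≤ K3) :
    I N (cl X ((p : ℤ) ^ a) ξ) (cl X ((p : ℤ) ^ b) η) 4 8 ≤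
      (2 * b : ℝ) * (p : ℝ) ^ (4 * (b - a)) * (4 * (K1 ^ (1 / 3 : ℝ) *
        ((p : ℝ) ^ (a + b) * (2 * (K2 ^ (1 / 4 : ℝ) * K3 ^ (3 / 4 : ℝ)))) ^ (2 / 3 : ℝ))) := by
  have hsymm : ∀ {x y : ℤ}, ¬ (p : ℤ) ∣ x - y → ¬ (p : ℤ) ∣ y - x := fun hxy hd =>
    hxy (by rw [← dvd_neg]; exact dcast hd (by ring))
  have hK30 : 0 ≤ K3 := (av_nonneg fun ψ => by positivity).trans (hK3 0)
  have hK20 : 0 ≤ K2 := (I_nonneg _ _ _ _).trans (hK2 ξ η h)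
  have hK10 : 0 ≤ K1 := (I_nonneg _ _ _ _).trans (hK1 ξ η h)
  refine lem4 hp hp5 ha hab hN h fun ξ' hξ' => ?_
  have i1 := I_interp (N := N) (cl X ((p : ℤ) ^ (2 * b - a)) ξ') (cl X ((p : ℤ) ^ b) η)
    (i := 8) (j := 4) (k := 2) (l := 10) (m := 4) (n := 8) (1 / 3) (by norm_num) (by norm_num)
    (by norm_num) (by norm_num)
  refine i1.trans ?_
  rw [I_comm _ _ 8 4]
  have e : (1 - 1 / 3 : ℝ) = 2 / 3 := by norm_num
  rw [e]
  refine mul_le_mul (Real.rpow_le_rpow (I_nonneg _ _ _ _) (hK1 η ξ' (hsymm hξ')) (by norm_num))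
    (Real.rpow_le_rpow (I_nonneg _ _ _ _) ?_ (by norm_num))
    (Real.rpow_nonneg (I_nonneg _ _ _ _) _) (Real.rpow_nonneg hK10 _)
  have i3 := lem3 (X := X) hp hp5 (a := 2 * b - a) (b := b) (by omega) (by omega) hN hξ'
    (K := K2 ^ (1 / 4 : ℝ) * K3 ^ (3 / 4 : ℝ)) ?_
  · rwa [show 3 * b - (2 * b - a) = a + b by omega] at i3
  intro x hx
  have i2 := I_interp (N := N) (cl X ((p : ℤ) ^ (3 * b)) x) (cl X ((p : ℤ) ^ b) η)
    (i := 8) (j := 4) (k := 0) (l := 12) (m := 2) (n := 10) (1 / 4) (by norm_num) (by norm_num)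
    (by norm_num) (by norm_num)
  refine i2.trans ?_
  rw [I_comm _ _ 8 4]
  have e' : (1 - 1 / 4 : ℝ) = 3 / 4 := by norm_num
  rw [e']
  have e0 : I N (cl X ((p : ℤ) ^ (3 * b)) x) (cl X ((p : ℤ) ^ b) η) 0 12 =
    av N (fun ψ => ‖f N (cl X ((p : ℤ) ^ b) η) ψ‖ ^ 12) := by simp [I]
  rw [e0]
  exact mul_le_mul (Real.rpow_le_rpow (I_nonneg _ _ _ _) (hK2 η x (hsymm hx)) (by norm_num))
    (Real.rpow_le_rpow (av_nonneg fun ψ => by positivity) (hK3 η) (by norm_num))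
    (Real.rpow_nonneg (av_nonneg fun ψ => by positivity) _) (Real.rpow_nonneg hK20 _)

lemma I48_trivial {a b : ℕ} {ξ η : ℤ} {Ka Kb : ℝ}
    (ha : av N (fun ψ => ‖f N (cl X ((p : ℤ) ^ a) ξ) ψ‖ ^ 12) ≤ Ka)
    (hb : av N (fun ψ => ‖f N (cl X ((p : ℤ) ^ b) η) ψ‖ ^ 12) ≤ Kb) :
    I N (cl X ((p : ℤ) ^ a) ξ) (cl X ((p : ℤ) ^ b) η) 4 8 ≤ Ka ^ (1 / 3 : ℝ) * Kb ^ (2 / 3 : ℝ) := by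
  have i1 := I_interp (N := N) (cl X ((p : ℤ) ^ a) ξ) (cl X ((p : ℤ) ^ b) η)
    (i := 12) (j := 0) (k := 0) (l := 12) (m := 4) (n := 8) (1 / 3) (by norm_num) (by norm_num)
    (by norm_num) (by norm_num)
  have e : (1 - 1 / 3 : ℝ) = 2 / 3 := by norm_num
  refine i1.trans ?_
  rw [e]
  have hKa : 0 ≤ Ka := (av_nonneg fun ψ => by positivity).trans ha
  refine mul_le_mul (Real.rpow_le_rpow (I_nonneg _ _ _ _) ?_ (by norm_num))
    (Real.rpow_le_rpow (I_nonneg _ _ _ _) ?_ (by norm_num))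
    (Real.rpow_nonneg (I_nonneg _ _ _ _) _) (Real.rpow_nonneg hKa _)
  · simpa [I] using ha
  · simpa [I] using hb

end

lemma pt_bound {ι : Type*} [DecidableEq ι] (s : Finset ι) (hs : s.Nonempty) (c : ι → ℝ)
    (hc : ∀ i, 0 ≤ c i) :
    (∑ i ∈ s, c i) ^ 12 ≤ 2 ^ 12 * ∑ i ∈ s, c i ^ 12 +
      (2 * #s) ^ 12 * ∑ i ∈ s, ∑ j ∈ s.erase i, c i ^ 6 * c j ^ 6 := by
  obtain ⟨i0, hi0, hmax⟩ := exists_max_image s c hs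
  have A1 : c i0 ^ 12 ≤ ∑ i ∈ s, c i ^ 12 :=
    single_le_sum (f := fun i => c i ^ 12) (fun i _ => pow_nonneg (hc i) _) hi0
  have hin : ∀ i ∈ s, 0 ≤ ∑ j ∈ s.erase i, c i ^ 6 * c j ^ 6 := fun i _ =>
    sum_nonneg fun j _ => mul_nonneg (pow_nonneg (hc i) _) (pow_nonneg (hc j) _)
  have B0 : 0 ≤ ∑ i ∈ s, ∑ j ∈ s.erase i, c i ^ 6 * c j ^ 6 := sum_nonneg hin
  rw [← add_sum_erase s c hi0]
  have h0 := hc i0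
  rcases (s.erase i0).eq_empty_or_nonempty with he | hne
  · rw [he, sum_empty, add_zero]
    have : 0 ≤ c i0 ^ 12 := by positivity
    have h2 : 0 ≤ (2 * (#s : ℝ)) ^ 12 * ∑ i ∈ s, ∑ j ∈ s.erase i, c i ^ 6 * c j ^ 6 :=
      mul_nonneg (pow_nonneg (by positivity) _) B0
    linarith
  obtain ⟨j0, hj0, hmax'⟩ := exists_max_image (s.erase i0) c hne
  have hj := hc j0
  have A2 : ∑ i ∈ s.erase i0, c i ≤ #s * c j0 := by
    refine (sum_le_card_nsmul _ _ _ hmax').trans ?_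
    rw [nsmul_eq_mul]
    refine mul_le_mul_of_nonneg_right ?_ hj
    exact_mod_cast card_le_card (erase_subset _ _)
  have A3 : c i0 ^ 6 * c j0 ^ 6 ≤ ∑ i ∈ s, ∑ j ∈ s.erase i, c i ^ 6 * c j ^ 6 :=
    (single_le_sum (f := fun j => c i0 ^ 6 * c j ^ 6) (fun j _ =>
      mul_nonneg (pow_nonneg (hc i0) _) (pow_nonneg (hc j) _)) hj0).trans
    (single_le_sum (f := fun i => ∑ j ∈ s.erase i, c i ^ 6 * c j ^ 6) hin hi0)
  have hsum0 : 0 ≤ ∑ i ∈ s.erase i0, c i := sum_nonneg fun i _ => hc i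
  rcases le_total (#s * c j0) (c i0) with hle | hle
  · calc (c i0 + ∑ i ∈ s.erase i0, c i) ^ 12 ≤ (2 * c i0) ^ 12 :=
        pow_le_pow_left₀ (by positivity) (by linarith) _
      _ = 2 ^ 12 * c i0 ^ 12 := by ring
      _ ≤ 2 ^ 12 * ∑ i ∈ s, c i ^ 12 := mul_le_mul_of_nonneg_left A1 (by norm_num)
      _ ≤ _ := le_add_of_nonneg_right (mul_nonneg (pow_nonneg (by positivity) _) B0)
  · have hji : c j0 ≤ c i0 := hmax _ (mem_of_mem_erase hj0)
    calc (c i0 + ∑ i ∈ s.erase i0, c i) ^ 12 ≤ (2 * #s * c j0) ^ 12 :=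
        pow_le_pow_left₀ (by positivity) (by linarith) _
      _ = (2 * #s) ^ 12 * (c j0 ^ 6 * c j0 ^ 6) := by ring
      _ ≤ (2 * #s) ^ 12 * (c i0 ^ 6 * c j0 ^ 6) := by gcongr
      _ ≤ (2 * #s) ^ 12 * ∑ i ∈ s, ∑ j ∈ s.erase i, c i ^ 6 * c j ^ 6 :=
        mul_le_mul_of_nonneg_left A3 (pow_nonneg (by positivity) _)
      _ ≤ _ := le_add_of_nonneg_left (mul_nonneg (by norm_num)
        (sum_nonneg fun i _ => pow_nonneg (hc i) _))

section
variable {N p X : ℕ} [NeZero N]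

lemma f_split (hp : 0 < p) (ψ : AddChar (V N) ℂ) :
    f N (Icc 1 (X : ℤ)) ψ = ∑ r ∈ Ico (0 : ℤ) p, f N (cl X ((p : ℤ) ^ 1) r) ψ := by
  have e0 : cl X ((p : ℤ) ^ 0) 0 = Icc 1 (X : ℤ) := by
    ext x; simp [cl]
  have hp' : (0 : ℤ) < p := by exact_mod_cast hp
  rw [← e0]
  unfold f
  rw [← sum_fiberwise_of_maps_to (t := Ico (0 : ℤ) p) (g := fun x => x % (p : ℤ) ^ 1)]
  · refine sum_congr rfl fun r hr => ?_
    rw [mem_Ico] at hr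
    rw [filter_cl (by norm_num) hr.1 (by simpa using hr.2) (by simp)]
  · intro x _
    simp only [pow_one, mem_Ico]
    exact ⟨Int.emod_nonneg _ hp'.ne', Int.emod_lt_of_pos _ hp'⟩

lemma lem1 (hp : 0 < p) {K0 K : ℝ} (hK00 : 0 ≤ K0) (hK0 : 0 ≤ K)
    (h0 : ∀ ξ : ℤ, av N (fun ψ => ‖f N (cl X ((p : ℤ) ^ 1) ξ) ψ‖ ^ 12) ≤ K0)
    (h : ∀ ξ η : ℤ, ¬ (p : ℤ) ∣ ξ - η →
      I N (cl X ((p : ℤ) ^ 1) ξ) (cl X ((p : ℤ) ^ 1) η) 4 8 ≤ K) :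
    av N (fun ψ => ‖f N (Icc 1 (X : ℤ)) ψ‖ ^ 12) ≤
      2 ^ 12 * (p * K0) + (2 * p) ^ 12 * (p * (p * K)) := by
  classical
  have hp' : (0 : ℤ) < p := by exact_mod_cast hp
  have hcard : #(Ico (0 : ℤ) p) = p := by simp
  have hpt : ∀ ψ : AddChar (V N) ℂ, ‖f N (Icc 1 (X : ℤ)) ψ‖ ^ 12 ≤
      2 ^ 12 * ∑ i ∈ Ico (0 : ℤ) p, ‖f N (cl X ((p : ℤ) ^ 1) i) ψ‖ ^ 12 +
      (2 * p) ^ 12 * ∑ i ∈ Ico (0 : ℤ) p, ∑ j ∈ (Ico (0 : ℤ) p).erase i,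
        ‖f N (cl X ((p : ℤ) ^ 1) i) ψ‖ ^ 6 * ‖f N (cl X ((p : ℤ) ^ 1) j) ψ‖ ^ 6 := by
    intro ψ
    have := pt_bound (Ico (0 : ℤ) p) ⟨0, by simpa using hp⟩
      (fun r => ‖f N (cl X ((p : ℤ) ^ 1) r) ψ‖) (fun _ => norm_nonneg _)
    rw [hcard] at this
    refine le_trans (pow_le_pow_left₀ (norm_nonneg _) ?_ _) this
    rw [f_split hp]
    exact norm_sum_le _ _
  refine (av_mono hpt).trans ?_
  rw [av_add, av_smul, av_smul, av_sum, av_sum]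
  refine add_le_add (mul_le_mul_of_nonneg_left ?_ (by norm_num))
    (mul_le_mul_of_nonneg_left ?_ (by positivity))
  · refine (sum_le_card_nsmul _ _ _ fun i _ => h0 i).trans ?_
    rw [hcard, nsmul_eq_mul]
  · refine (sum_le_card_nsmul _ _ (p * K) fun i hi => ?_).trans ?_
    · rw [av_sum]
      refine (sum_le_card_nsmul _ _ K fun j hj => ?_).trans ?_
      · rw [mem_erase, mem_Ico] at hj
        rw [mem_Ico] at hi
        have hnd : ∀ {u v : ℤ}, 0 ≤ u → u < p → 0 ≤ v → v < p → u ≠ v → ¬ (p : ℤ) ∣ u - v := by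
          intro u v h1 h2 h3 h4 hne hd
          have := Int.emod_eq_emod_iff_emod_sub_eq_zero.2 (Int.emod_eq_zero_of_dvd hd)
          rw [Int.emod_eq_of_lt h1 h2, Int.emod_eq_of_lt h3 h4] at this
          exact hne this
        have g1 := h i j (hnd hi.1 hi.2 hj.2.1 hj.2.2 hj.1.symm)
        have g2 := h j i (hnd hj.2.1 hj.2.2 hi.1 hi.2 hj.1)
        rw [I_comm] at g2
        have i1 := I_interp (N := N) (cl X ((p : ℤ) ^ 1) i) (cl X ((p : ℤ) ^ 1) j)
          (i := 4) (j := 8) (k := 8) (l := 4) (m := 6) (n := 6) (1 / 2) (by norm_num) (by norm_num)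
          (by norm_num) (by norm_num)
        refine i1.trans ?_
        calc _ ≤ K ^ (1 / 2 : ℝ) * K ^ (1 - 1 / 2 : ℝ) :=
            mul_le_mul (Real.rpow_le_rpow (I_nonneg _ _ _ _) g1 (by norm_num))
              (Real.rpow_le_rpow (I_nonneg _ _ _ _) g2 (by norm_num))
              (Real.rpow_nonneg (I_nonneg _ _ _ _) _) (Real.rpow_nonneg hK0 _)
          _ = K := by
            rw [← Real.rpow_add_of_nonneg hK0 (by norm_num) (by norm_num)]; norm_num
      · rw [nsmul_eq_mul]
        refine mul_le_mul_of_nonneg_right ?_ hK0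
        have := card_le_card (erase_subset i (Ico (0 : ℤ) p))
        rw [hcard] at this
        exact_mod_cast this
    · rw [hcard, nsmul_eq_mul]

end
end VMVT

namespace VMVT
open Finset
set_option linter.unusedSectionVars false

/-- Twelfth moment bound with exponent `6 + δ` and constant `C`. -/
def PB (C δ : ℝ) : Prop := 0 ≤ C ∧ ∀ Y : ℕ, 1 ≤ Y →
  (JZ 6 (Icc 1 (Y : ℤ)) : ℝ) ≤ C * (Y : ℝ) ^ (6 + δ)

lemma kpow {D X P E e θ : ℝ} (hD : 0 ≤ D) (hX : 0 < X) (hP : 0 < P) :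
    (D * X ^ E * P ^ e) ^ θ = D ^ θ * X ^ (E * θ) * P ^ (e * θ) := by
  rw [Real.mul_rpow (by positivity) (by positivity), Real.mul_rpow hD (by positivity),
    ← Real.rpow_mul hX.le, ← Real.rpow_mul hP.le]

section
variable {N p X : ℕ} [NeZero N]

lemma cl12 {C δ : ℝ} (hC : PB C δ) (hδ : 0 ≤ δ) (hp : 0 < p) {b : ℕ} (hb : p ^ b ≤ X)
    (hN : 6 * X ^ 3 < N) (η : ℤ) :
    av N (fun ψ => ‖f N (cl X ((p : ℤ) ^ b) η) ψ‖ ^ 12) ≤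
      C * 2 ^ (6 + δ) * (X : ℝ) ^ (6 + δ) * (p : ℝ) ^ (-(b : ℝ) * (6 + δ)) := by
  have hq : 0 < p ^ b := pow_pos hp b
  have h1 := av_eq_JZ (cl_sub X ((p : ℤ) ^ b) η) 6 hN
  have h2 := JZ_cl 6 X (p ^ b) hq η
  rw [Nat.cast_pow] at h2
  have h1' : av N (fun ψ => ‖f N (cl X ((p : ℤ) ^ b) η) ψ‖ ^ 12) =
      JZ 6 (cl X ((p : ℤ) ^ b) η) := h1
  rw [h1']
  have h3 : (JZ 6 (cl X ((p : ℤ) ^ b) η) : ℝ) ≤ JZ 6 (Icc 1 ((X / p ^ b + 1 : ℕ) : ℤ)) := by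
    exact_mod_cast h2
  refine h3.trans ((hC.2 _ (Nat.le_add_left 1 _)).trans ?_)
  have hp' : (0 : ℝ) < p := by exact_mod_cast hp
  have h4 : ((X / p ^ b + 1 : ℕ) : ℝ) ≤ 2 * X * (p : ℝ) ^ (-(b : ℝ)) := by
    rw [Real.rpow_neg hp'.le, Real.rpow_natCast, ← div_eq_mul_inv, le_div_iff₀ (by positivity)]
    have : (X / p ^ b + 1) * p ^ b ≤ 2 * X := by
      have := Nat.div_mul_le_self X (p ^ b)
      rw [add_mul]; omega
    exact_mod_cast this
  have h5 := Real.rpow_le_rpow (by positivity) h4 (show 0 ≤ 6 + δ by linarith)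
  rw [Real.mul_rpow (by positivity) (by positivity), Real.mul_rpow (by positivity) (by positivity),
    ← Real.rpow_mul hp'.le] at h5
  calc _ ≤ C * _ := mul_le_mul_of_nonneg_left h5 hC.1
    _ = _ := by ring

end

lemma step_alg {D D3 X P E e1 e2 e3 c : ℝ} (u v : ℕ) (hD : 0 ≤ D) (hD3 : 0 ≤ D3) (hX : 0 < X)
    (hP : 0 < P) :
    c * P ^ u * (4 * ((D * X ^ E * P ^ e1) ^ (1 / 3 : ℝ) *
      (P ^ v * (2 * ((D * X ^ E * P ^ e2) ^ (1 / 4 : ℝ) * (D3 * X ^ E * P ^ e3) ^ (3 / 4 : ℝ))))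
        ^ (2 / 3 : ℝ))) =
    c * (4 * D ^ (1 / 3 : ℝ) * (2 * D ^ (1 / 4 : ℝ) * D3 ^ (3 / 4 : ℝ)) ^ (2 / 3 : ℝ)) * X ^ E *
      P ^ (u + e1 / 3 + (2 / 3) * v + e2 / 6 + e3 / 2) := by
  have hin : P ^ v * (2 * ((D * X ^ E * P ^ e2) ^ (1 / 4 : ℝ) * (D3 * X ^ E * P ^ e3) ^ (3 / 4 : ℝ)))
      = (2 * D ^ (1 / 4 : ℝ) * D3 ^ (3 / 4 : ℝ)) * X ^ E * P ^ ((v : ℝ) + e2 / 4 + e3 * (3 / 4)) := by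
    rw [kpow hD hX hP, kpow hD3 hX hP, Real.rpow_add hP, Real.rpow_add hP, Real.rpow_natCast]
    have : X ^ E = X ^ (E * (1 / 4)) * X ^ (E * (3 / 4)) := by
      rw [← Real.rpow_add hX]; ring_nf
    rw [this, show e2 * (1 / 4) = e2 / 4 by ring]
    ring
  have hQ : 0 ≤ 2 * D ^ (1 / 4 : ℝ) * D3 ^ (3 / 4 : ℝ) := by positivity
  rw [hin, kpow hQ hX hP, kpow hD hX hP]
  have h1 : X ^ E = X ^ (E * (1 / 3)) * X ^ (E * (2 / 3)) := by
    rw [← Real.rpow_add hX]; ring_nf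
  have h2 : P ^ (u + e1 / 3 + (2 / 3) * v + e2 / 6 + e3 / 2) =
      P ^ u * P ^ (e1 * (1 / 3)) * P ^ (((v : ℝ) + e2 / 4 + e3 * (3 / 4)) * (2 / 3)) := by
    rw [← Real.rpow_natCast, ← Real.rpow_add hP, ← Real.rpow_add hP]; ring_nf
  rw [h1, h2]; ring

lemma iter {C δ : ℝ} (hC : PB C δ) (hδ : 0 < δ) (n : ℕ) : ∀ B : ℕ, ∃ D : ℝ, 0 ≤ D ∧
    ∀ (p X N : ℕ) [NeZero N], p.Prime → 5 ≤ p → (∃ L, N = p ^ L) → 6 * X ^ 3 < N →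
    ∀ a b : ℕ, 1 ≤ a → a ≤ b → b ≤ B → p ^ (3 ^ n * b) ≤ X → ∀ ξ η : ℤ, ¬ (p : ℤ) ∣ ξ - η →
      I N (cl X ((p : ℤ) ^ a) ξ) (cl X ((p : ℤ) ^ b) η) 4 8 ≤
        D * (X : ℝ) ^ (6 + δ) * (p : ℝ) ^ (-2 * (a : ℝ) - 4 * b - n * (3 * b - a) * δ / 6) := by
  have hC0 := hC.1
  induction n with
  | zero =>
    intro B
    refine ⟨C * 2 ^ (6 + δ), by positivity, ?_⟩
    intro p X N _ hp hp5 _ hN a b ha hab _ hX ξ η _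
    rw [pow_zero, one_mul] at hX
    have hp0 := hp.pos
    have hX0 : 0 < X := lt_of_lt_of_le (pow_pos hp0 _) hX
    have hpa : p ^ a ≤ X := (Nat.pow_le_pow_right hp0 hab).trans hX
    have hX' : (0 : ℝ) < X := by exact_mod_cast hX0
    have hp' : (0 : ℝ) < p := by exact_mod_cast hp0
    have hp1 : (1 : ℝ) ≤ p := by exact_mod_cast hp0
    refine (I48_trivial (cl12 hC hδ.le hp0 hpa hN ξ) (cl12 hC hδ.le hp0 hX hN η)).trans ?_
    have hDD : 0 ≤ C * 2 ^ (6 + δ) := by positivity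
    rw [kpow hDD hX' hp', kpow hDD hX' hp']
    set D := C * 2 ^ (6 + δ)
    have e1 : D ^ (1 / 3 : ℝ) * D ^ (2 / 3 : ℝ) = D := by
      rw [← Real.rpow_add_of_nonneg hDD (by norm_num) (by norm_num)]; norm_num
    have e2 : (X : ℝ) ^ ((6 + δ) * (1 / 3)) * (X : ℝ) ^ ((6 + δ) * (2 / 3)) = (X : ℝ) ^ (6 + δ) := by
      rw [← Real.rpow_add hX']; ring_nf
    calc _ = (D ^ (1 / 3 : ℝ) * D ^ (2 / 3 : ℝ)) *
          ((X : ℝ) ^ ((6 + δ) * (1 / 3)) * (X : ℝ) ^ ((6 + δ) * (2 / 3))) *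
          ((p : ℝ) ^ (-(a : ℝ) * (6 + δ) * (1 / 3)) * (p : ℝ) ^ (-(b : ℝ) * (6 + δ) * (2 / 3))) := by
          ring
      _ ≤ _ := by
        rw [e1, e2, ← Real.rpow_add hp']
        refine mul_le_mul_of_nonneg_left (Real.rpow_le_rpow_of_exponent_le hp1 ?_) (by positivity)
        have h1 : 0 ≤ (a : ℝ) * δ := by positivity
        have h2 : 0 ≤ (b : ℝ) * δ := by positivity
        push_cast
        nlinarith
  | succ n ih =>
    intro B
    obtain ⟨D, hD, H⟩ := ih (3 * B)
    set D3 := C * 2 ^ (6 + δ) with hD3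
    have hD30 : 0 ≤ D3 := by positivity
    refine ⟨2 * B * (4 * D ^ (1 / 3 : ℝ) * (2 * D ^ (1 / 4 : ℝ) * D3 ^ (3 / 4 : ℝ)) ^ (2 / 3 : ℝ)),
      by positivity, ?_⟩
    intro p X N _ hp hp5 hNL hN a b ha hab hbB hX ξ η hξη
    have hp0 := hp.pos
    have hX0 : 0 < X := lt_of_lt_of_le (pow_pos hp0 _) hX
    have hX' : (0 : ℝ) < X := by exact_mod_cast hX0
    have hp' : (0 : ℝ) < p := by exact_mod_cast hp0
    have hp1 : (1 : ℝ) ≤ p := by exact_mod_cast hp0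
    have h3n : 1 ≤ 3 ^ n := Nat.one_le_pow _ _ (by norm_num)
    have hX3 : p ^ (3 ^ n * (3 * b)) ≤ X := by
      rwa [show 3 ^ n * (3 * b) = 3 ^ (n + 1) * b by ring]
    have hX2 : p ^ (3 ^ n * (2 * b - a)) ≤ X :=
      (Nat.pow_le_pow_right hp0 (Nat.mul_le_mul_left _ (by omega))).trans hX3
    have hXb3 : p ^ (3 * b) ≤ X :=
      (Nat.pow_le_pow_right hp0 (Nat.le_mul_of_pos_left _ (by omega))).trans hX3
    have hXb : p ^ b ≤ X := (Nat.pow_le_pow_right hp0 (by omega)).trans hXb3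
    have hdvd : p ^ (3 * b) ∣ N := by
      obtain ⟨L, rfl⟩ := hNL
      apply pow_dvd_pow
      have : X ≤ X ^ 3 := Nat.le_self_pow (by norm_num) X
      exact ((Nat.pow_lt_pow_iff_right hp.one_lt).1 (by omega : p ^ (3 * b) < p ^ L)).le
    have key := lem5 (X := X) hp hp5 ha hab hdvd hξη
      (H p X N hp hp5 hNL hN b (2 * b - a) (by omega) (by omega) (by omega) hX2)
      (H p X N hp hp5 hNL hN b (3 * b) (by omega) (by omega) (by omega) hX3)
      (cl12 hC hδ.le hp0 hXb hN)
    rw [← hD3, step_alg _ _ hD hD30 hX' hp'] at key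
    refine key.trans ?_
    have hbB' : (b : ℝ) ≤ B := by exact_mod_cast hbB
    have hab' : (a : ℝ) ≤ b := by exact_mod_cast hab
    refine mul_le_mul (by gcongr) (Real.rpow_le_rpow_of_exponent_le hp1 ?_) (by positivity)
      (by positivity)
    have c1 : ((4 * (b - a) : ℕ) : ℝ) = 4 * (b - a) := by push_cast [Nat.cast_sub hab]; ring
    have c2 : ((2 * b - a : ℕ) : ℝ) = 2 * b - a := by
      rw [Nat.cast_sub (by omega)]; push_cast; ring
    rw [c1, c2]
    push_cast
    have h1 : 0 ≤ (a : ℝ) * δ := by positivity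
    have : -2 * (a : ℝ) - 4 * b - (n + 1) * (3 * b - a) * δ / 6 -
      (4 * ((b : ℝ) - a) + (-2 * b - 4 * (2 * b - a) - n * (3 * (2 * b - a) - b) * δ / 6) / 3 +
        2 / 3 * (a + b) + (-2 * b - 4 * (3 * b) - n * (3 * (3 * b) - b) * δ / 6) / 6 +
        -b * (6 + δ) / 2) = a * δ / 6 := by ring
    linarith
end VMVT

namespace VMVT
open Finset
set_option linter.unusedSectionVars false

lemma av_one {N : ℕ} [NeZero N] : av N (fun _ => 1) = 1 := by
  have h : Fintype.card (AddChar (V N) ℂ) = Fintype.card (V N) := AddChar.card_eq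
  have := card_pos' (N := N)
  simp only [av, sum_const, card_univ, nsmul_eq_mul, mul_one]
  rw [h]
  exact div_self this.ne'

lemma triv12 (Y : ℕ) : (JZ 6 (Icc 1 (Y : ℤ)) : ℝ) ≤ (Y : ℝ) ^ 12 := by
  have h1 := av_eq_JZ (N := 6 * Y ^ 3 + 1) (subset_refl (Icc 1 (Y : ℤ))) 6 (by omega)
  rw [← h1]
  calc _ ≤ av (6 * Y ^ 3 + 1) (fun _ => (Y : ℝ) ^ 12 * 1) := av_mono fun ψ => by
        rw [mul_one]
        refine pow_le_pow_left₀ (norm_nonneg _) ((norm_f_le _ _).trans ?_) _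
        simp
    _ = _ := by rw [av_smul, av_one, mul_one]

lemma PB_six : PB 1 6 := by
  refine ⟨by norm_num, fun Y _ => (triv12 Y).trans ?_⟩
  rw [one_mul, show (6 + 6 : ℝ) = ((12 : ℕ) : ℝ) by norm_num, Real.rpow_natCast]

lemma PB_mono {C δ δ' : ℝ} (h : PB C δ) (hd : δ ≤ δ') : PB C δ' :=
  ⟨h.1, fun Y hY => (h.2 Y hY).trans (mul_le_mul_of_nonneg_left
    (Real.rpow_le_rpow_of_exponent_le (by exact_mod_cast hY) (by linarith)) h.1)⟩

lemma find_prime {M X : ℕ} (hM : 0 < M) (hX : 8 ^ M ≤ X) : ∃ p : ℕ, p.Prime ∧ 5 ≤ p ∧ p ^ M ≤ X ∧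
    (X : ℝ) ^ (1 / (M : ℝ)) ≤ 3 * p := by
  set t := (X : ℝ) ^ (1 / (M : ℝ)) with ht
  have hM' : (M : ℝ) ≠ 0 := by exact_mod_cast hM.ne'
  have ht0 : 0 ≤ t := by positivity
  have htM : t ^ M = X := by
    rw [ht, ← Real.rpow_natCast, ← Real.rpow_mul (by positivity), one_div_mul_cancel hM',
      Real.rpow_one]
  have h8 : (8 : ℝ) ≤ t := by
    refine le_of_pow_le_pow_left₀ hM.ne' ht0 ?_
    rw [htM]; exact_mod_cast hX
  set r := ⌊t⌋₊ with hr
  have hr8 : 8 ≤ r := Nat.le_floor (by exact_mod_cast h8)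
  have hrt : (r : ℝ) ≤ t := Nat.floor_le ht0
  have htr : t < r + 1 := Nat.lt_floor_add_one t
  obtain ⟨p, hp, hp1, hp2⟩ := Nat.exists_prime_lt_and_le_two_mul (r / 2) (by omega)
  refine ⟨p, hp, by omega, ?_, ?_⟩
  · have hpr : p ≤ r := by omega
    have : (p : ℝ) ^ M ≤ X := by
      rw [← htM]
      exact pow_le_pow_left₀ (by positivity) (le_trans (by exact_mod_cast hpr) hrt) _
    exact_mod_cast this
  · have : r + 1 ≤ 3 * p := by omega
    have : (r : ℝ) + 1 ≤ 3 * p := by exact_mod_cast this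
    linarith

lemma descent {δ0 : ℝ} (h0 : 0 < δ0) {n : ℕ} (hn : 9 ≤ n * δ0 / 3) {C δ : ℝ} (hδ : δ0 ≤ δ)
    (hC : PB C δ) : ∃ C', PB C' (δ - 1 / ((3 ^ n : ℕ) : ℝ)) := by
  have hδ0 : 0 < δ := by linarith
  obtain ⟨D, hD, H⟩ := iter hC hδ0 n 1
  have hC0 := hC.1
  set M := 3 ^ n with hM
  have hM1 : 1 ≤ M := Nat.one_le_pow _ _ (by norm_num)
  have hMr : (1 : ℝ) ≤ M := by exact_mod_cast hM1
  have hMi : 1 / (M : ℝ) ≤ 1 := by rw [div_le_one (by linarith)]; exact hMr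
  set D3 := C * 2 ^ (6 + δ) with hD3
  have hD30 : 0 ≤ D3 := by positivity
  refine ⟨2 ^ 12 * (D3 + D) * 3 + ((8 : ℝ) ^ M) ^ 12, by positivity, fun X hX1 => ?_⟩
  have hX' : (1 : ℝ) ≤ X := by exact_mod_cast hX1
  have hX0 : (0 : ℝ) < X := by linarith
  rcases le_total (8 ^ M) X with hX | hX
  · obtain ⟨p, hp, hp5, hpM, hpt⟩ := find_prime hM1 hX
    have hp0 := hp.pos
    have hp1 : (1 : ℝ) ≤ p := by exact_mod_cast hp0
    have hp' : (0 : ℝ) < p := by linarith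
    have hN : 6 * X ^ 3 < p ^ (6 * X ^ 3) := Nat.lt_pow_self hp.one_lt
    haveI : NeZero (p ^ (6 * X ^ 3)) := ⟨by omega⟩
    have hpX : p ^ 1 ≤ X := (Nat.pow_le_pow_right hp0 hM1).trans hpM
    have k1 := cl12 (N := p ^ (6 * X ^ 3)) hC hδ0.le hp0 hpX hN
    have k2 := H p X (p ^ (6 * X ^ 3)) hp hp5 ⟨_, rfl⟩ hN 1 1 le_rfl le_rfl le_rfl
      (by rwa [mul_one])
    have key := lem1 hp0 (by positivity) (by positivity) k1 k2
    have h1 := av_eq_JZ (N := p ^ (6 * X ^ 3)) (subset_refl (Icc 1 (X : ℤ))) 6 hN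
    have h1' : av (p ^ (6 * X ^ 3)) (fun ψ => ‖f (p ^ (6 * X ^ 3)) (Icc 1 (X : ℤ)) ψ‖ ^ 12) =
      JZ 6 (Icc 1 (X : ℤ)) := h1
    rw [h1'] at key
    refine key.trans ?_
    rw [← hD3]
    have q1 : (p : ℝ) * (p : ℝ) ^ (-((1 : ℕ) : ℝ) * (6 + δ)) ≤ (p : ℝ) ^ (-1 : ℝ) := by
      calc _ = (p : ℝ) ^ (1 : ℝ) * (p : ℝ) ^ (-((1 : ℕ) : ℝ) * (6 + δ)) := by rw [Real.rpow_one]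
        _ ≤ _ := by
          rw [← Real.rpow_add hp']
          refine Real.rpow_le_rpow_of_exponent_le hp1 ?_
          push_cast; linarith
    have q2 : (p : ℝ) ^ 14 * (p : ℝ) ^ (-2 * ((1 : ℕ) : ℝ) - 4 * ((1 : ℕ) : ℝ) -
        n * (3 * ((1 : ℕ) : ℝ) - ((1 : ℕ) : ℝ)) * δ / 6) ≤ (p : ℝ) ^ (-1 : ℝ) := by
      rw [← Real.rpow_natCast, ← Real.rpow_add hp']
      refine Real.rpow_le_rpow_of_exponent_le hp1 ?_
      have : (n : ℝ) * δ0 ≤ n * δ := mul_le_mul_of_nonneg_left hδ (by positivity)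
      push_cast; linarith
    have q3 : (p : ℝ) ^ (-1 : ℝ) ≤ 3 * (X : ℝ) ^ (-(1 / (M : ℝ))) := by
      rw [Real.rpow_neg_one, Real.rpow_neg hX0.le, inv_le_iff_one_le_mul₀ hp']
      rw [mul_assoc, mul_comm, mul_assoc, ← div_eq_inv_mul, le_div_iff₀ (by positivity)]
      linarith
    set A1 := (p : ℝ) ^ (-((1 : ℕ) : ℝ) * (6 + δ))
    set A2 := (p : ℝ) ^ (-2 * ((1 : ℕ) : ℝ) - 4 * ((1 : ℕ) : ℝ) -
        n * (3 * ((1 : ℕ) : ℝ) - ((1 : ℕ) : ℝ)) * δ / 6)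
    set E := (X : ℝ) ^ (6 + δ) with hE
    have hE0 : 0 ≤ E := by positivity
    calc _ = 2 ^ 12 * E * D3 * (p * A1) + 2 ^ 12 * E * D * (p ^ 14 * A2) := by ring
      _ ≤ 2 ^ 12 * E * D3 * (3 * (X : ℝ) ^ (-(1 / (M : ℝ)))) +
          2 ^ 12 * E * D * (3 * (X : ℝ) ^ (-(1 / (M : ℝ)))) :=
        add_le_add (mul_le_mul_of_nonneg_left (q1.trans q3) (by positivity))
          (mul_le_mul_of_nonneg_left (q2.trans q3) (by positivity))
      _ = 2 ^ 12 * (D3 + D) * 3 * (E * (X : ℝ) ^ (-(1 / (M : ℝ)))) := by ring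
      _ = 2 ^ 12 * (D3 + D) * 3 * (X : ℝ) ^ (6 + (δ - 1 / (M : ℝ))) := by
        rw [hE, ← Real.rpow_add hX0]; ring_nf
      _ ≤ _ := mul_le_mul_of_nonneg_right (le_add_of_nonneg_right (by positivity)) (by positivity)
  · refine (triv12 X).trans ?_
    have e1 : (1 : ℝ) ≤ (X : ℝ) ^ (6 + (δ - 1 / (M : ℝ))) :=
      Real.one_le_rpow hX' (by linarith)
    have e2 : (X : ℝ) ^ 12 ≤ ((8 : ℝ) ^ M) ^ 12 :=
      pow_le_pow_left₀ hX0.le (by exact_mod_cast hX) _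
    have e3 : 0 ≤ 2 ^ 12 * (D3 + D) * 3 := by positivity
    calc _ ≤ (2 ^ 12 * (D3 + D) * 3 + ((8 : ℝ) ^ M) ^ 12) * 1 := by linarith
      _ ≤ _ := mul_le_mul_of_nonneg_left e1 (by positivity)

lemma PB_all {δ0 : ℝ} (h0 : 0 < δ0) : ∃ C, PB C δ0 := by
  obtain ⟨n, hn⟩ := exists_nat_ge (27 / δ0)
  have hn' : 9 ≤ n * δ0 / 3 := by
    rw [div_le_iff₀ h0] at hn; linarith
  set κ := 1 / ((3 ^ n : ℕ) : ℝ) with hκ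
  have hκ0 : 0 < κ := by positivity
  have main : ∀ k : ℕ, ∃ C, PB C (max δ0 (6 - k * κ)) := by
    intro k
    induction k with
    | zero => exact ⟨1, PB_mono PB_six (by simp)⟩
    | succ k ih =>
      obtain ⟨C, hC⟩ := ih
      rcases le_total (6 - k * κ) δ0 with h | h
      · rw [max_eq_left h] at hC
        exact ⟨C, PB_mono hC (le_max_left _ _)⟩
      · rw [max_eq_right h] at hC
        obtain ⟨C', hC'⟩ := descent h0 hn' h hC
        refine ⟨C', PB_mono hC' (le_max_of_le_right ?_)⟩
        push_cast
        rw [hκ]; push_cast; linarith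
  obtain ⟨k, hk⟩ := exists_nat_ge (6 / κ)
  rw [div_le_iff₀ hκ0] at hk
  obtain ⟨C, hC⟩ := main k
  rw [max_eq_left (by linarith)] at hC
  exact ⟨C, hC⟩

lemma small_s {C ε : ℝ} (hC : PB C ε) {s : ℕ} (hs : s < 6) {Y : ℕ} (hY : 1 ≤ Y) :
    (JZ s (Icc 1 (Y : ℤ)) : ℝ) ≤ (C * (Y : ℝ) ^ (6 + ε)) ^ ((s : ℝ) / 6) := by
  have h1 := av_eq_JZ (N := 6 * Y ^ 3 + 1) (subset_refl (Icc 1 (Y : ℤ))) 6 (by omega)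
  have h2 := av_eq_JZ (N := 6 * Y ^ 3 + 1) (subset_refl (Icc 1 (Y : ℤ))) s
    (by have := Nat.mul_le_mul_right (Y ^ 3) hs.le; omega)
  rw [← h2]
  rcases Nat.eq_zero_or_pos s with rfl | hs0
  · simp [av_one]
  · have hs' : (0 : ℝ) < s := by exact_mod_cast hs0
    have hs6 : (s : ℝ) < 6 := by exact_mod_cast hs
    have i1 := I_interp (N := 6 * Y ^ 3 + 1) (Icc 1 (Y : ℤ)) (Icc 1 (Y : ℤ))
      (i := 12) (j := 0) (k := 0) (l := 0) (m := 2 * s) (n := 0) ((s : ℝ) / 6) (by positivity)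
      (by linarith) (by push_cast; ring) (by simp)
    have e0 : I (6 * Y ^ 3 + 1) (Icc 1 (Y : ℤ)) (Icc 1 (Y : ℤ)) 0 0 = 1 := by simp [I, av_one]
    have e1 : I (6 * Y ^ 3 + 1) (Icc 1 (Y : ℤ)) (Icc 1 (Y : ℤ)) 12 0 = JZ 6 (Icc 1 (Y : ℤ)) := by
      rw [← h1]; simp [I]
    have e2 : I (6 * Y ^ 3 + 1) (Icc 1 (Y : ℤ)) (Icc 1 (Y : ℤ)) (2 * s) 0 =
      av (6 * Y ^ 3 + 1) (fun ψ => ‖f (6 * Y ^ 3 + 1) (Icc 1 (Y : ℤ)) ψ‖ ^ (2 * s)) := by simp [I]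
    rw [e0, e1, e2, Real.one_rpow, mul_one] at i1
    exact i1.trans (Real.rpow_le_rpow (by positivity) (hC.2 Y hY) (by positivity))

lemma large_s {C ε : ℝ} (hC : PB C ε) {s : ℕ} (hs : 6 ≤ s) {Y : ℕ} (hY : 1 ≤ Y) :
    (JZ s (Icc 1 (Y : ℤ)) : ℝ) ≤ (Y : ℝ) ^ (2 * s - 12) * (C * (Y : ℝ) ^ (6 + ε)) := by
  have h1 := av_eq_JZ (N := s * Y ^ 3 + 1) (subset_refl (Icc 1 (Y : ℤ))) 6
    (by have := Nat.mul_le_mul_right (Y ^ 3) hs; omega)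
  have h2 := av_eq_JZ (N := s * Y ^ 3 + 1) (subset_refl (Icc 1 (Y : ℤ))) s (by omega)
  rw [← h2]
  refine le_trans ?_ (mul_le_mul_of_nonneg_left (hC.2 Y hY) (by positivity))
  rw [← h1, ← av_smul]
  refine av_mono fun ψ => ?_
  rw [show 2 * s = (2 * s - 12) + 2 * 6 by omega, pow_add, show 2 * s - 12 + 2 * 6 - 12 = 2 * s - 12 by omega]
  refine mul_le_mul_of_nonneg_right ?_ (by positivity)
  refine pow_le_pow_left₀ (norm_nonneg _) ((norm_f_le _ _).trans ?_) _
  simp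

end VMVT

theorem main_conjecture_cubic (s : ℕ) (ε : ℝ) (hε : ε > 0) : ∃ C : ℝ, ∀ X : ℝ, X ≥ 1 →
    (J s 3 X : ℝ) ≤ C * X ^ ε * (X ^ (s : ℝ) + X ^ (2 * (s : ℝ) - 6)) := by
  obtain ⟨C, hC⟩ := VMVT.PB_all hε
  have hC0 := hC.1
  refine ⟨C ^ ((s : ℝ) / 6) + C, fun X hX => ?_⟩
  have hX0 : 0 < X := by linarith
  set Y := ⌊X⌋₊ with hYdef
  have hY : 1 ≤ Y := Nat.le_floor (by exact_mod_cast hX)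
  have hYX : (Y : ℝ) ≤ X := Nat.floor_le hX0.le
  rw [VMVT.J_eq, show ⌊X⌋ = (Y : ℤ) from (Int.natCast_floor_eq_floor hX0.le).symm]
  have hA : 0 ≤ C ^ ((s : ℝ) / 6) := by positivity
  have hE : 0 < X ^ ε := by positivity
  have hS : 0 < X ^ (s : ℝ) := by positivity
  have hT : 0 < X ^ (2 * (s : ℝ) - 6) := by positivity
  rcases lt_or_ge s 6 with hs | hs
  · have hs6 : (s : ℝ) ≤ 6 := by exact_mod_cast hs.le
    calc _ ≤ (C * (Y : ℝ) ^ (6 + ε)) ^ ((s : ℝ) / 6) := VMVT.small_s hC hs hY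
      _ ≤ (C * X ^ (6 + ε)) ^ ((s : ℝ) / 6) := by gcongr
      _ = C ^ ((s : ℝ) / 6) * X ^ ((6 + ε) * (s / 6)) := by
        rw [Real.mul_rpow hC0 (by positivity), ← Real.rpow_mul hX0.le]
      _ ≤ C ^ ((s : ℝ) / 6) * X ^ (ε + s) := by
        refine mul_le_mul_of_nonneg_left (Real.rpow_le_rpow_of_exponent_le hX ?_) hA
        nlinarith
      _ = C ^ ((s : ℝ) / 6) * X ^ ε * X ^ (s : ℝ) := by rw [Real.rpow_add hX0]; ring
      _ ≤ _ := mul_le_mul (mul_le_mul_of_nonneg_right (by linarith) hE.le) (by linarith) hS.le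
        (by positivity)
  · calc _ ≤ (Y : ℝ) ^ (2 * s - 12) * (C * (Y : ℝ) ^ (6 + ε)) := VMVT.large_s hC hs hY
      _ ≤ X ^ (2 * s - 12) * (C * X ^ (6 + ε)) := by gcongr
      _ = C * X ^ ε * X ^ (2 * (s : ℝ) - 6) := by
        have : X ^ ε * X ^ (2 * (s : ℝ) - 6) = X ^ (2 * s - 12) * X ^ (6 + ε) := by
          rw [← Real.rpow_natCast, ← Real.rpow_add hX0, ← Real.rpow_add hX0,
            Nat.cast_sub (by omega)]
          push_cast; ring_nf
        rw [mul_assoc, this]; ring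
      _ ≤ _ := mul_le_mul (mul_le_mul_of_nonneg_right (by linarith) hE.le) (by linarith) hT.le
        (by positivity)
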